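/- arXiv:1712.03406 — 8 statements merged into one kernel-verified Lean document; each statement's English description precedes it below -/
import Mathlib

section
/- The infinite dihedral group is strongly verbally closed: it is algebraically closed in every group containing it as a verbally closed subgroup. -/
/-- A subgroup `H` of a group `G` is verbally closed in `G` if every equation
`w(x₁,…,xₙ) = h` with `w` in a free group and `h ∈ H` that has a solution in `G`
has a solution in `H`. -/
def VerballyClosedIn (G : Type*) [Group G] (H : Subgroup G) : Prop :=
  ∀ (n : ℕ) (w : FreeGroup (Fin n)) (h : G), h ∈ H →
    (∃ g : Fin n → G, FreeGroup.lift g w = h) →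
    ∃ x : Fin n → G, (∀ i, x i ∈ H) ∧ FreeGroup.lift x w = h

/-- A subgroup `H` of a group `G` is algebraically closed in `G` if every finite system
of equations `wᵢ(x₁,…,xₙ) = 1` with coefficients in `H` (i.e. `wᵢ ∈ H ∗ F(x₁,…,xₙ)`)
that has a solution in `G` has a solution in `H`. -/
def AlgebraicallyClosedIn (G : Type*) [Group G] (H : Subgroup G) : Prop :=
  ∀ (n m : ℕ) (w : Fin m → Monoid.Coprod H (FreeGroup (Fin n))),
    (∃ g : Fin n → G, ∀ i, Monoid.Coprod.lift H.subtype (FreeGroup.lift g) (w i) = 1) →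
    ∃ x : Fin n → G, (∀ j, x j ∈ H) ∧
      ∀ i, Monoid.Coprod.lift H.subtype (FreeGroup.lift x) (w i) = 1

/-- A group `H` is strongly verbally closed if it is algebraically closed in every
group containing it as a verbally closed subgroup (overgroups are given by injective
homomorphisms). -/
def StronglyVerballyClosed (H : Type*) [Group H] : Prop :=
  ∀ (G : Type*) [Group G] (f : H →* G), Function.Injective f →
    VerballyClosedIn G f.range → AlgebraicallyClosedIn G f.range

namespace InfiniteDihedral

open DihedralGroup

/-- The homomorphism `D∞ → {±1}` that sends rotations to `1` and reflections to `-1`. -/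
def sign : DihedralGroup 0 →* ℤˣ where
  toFun
    | r _ => 1
    | sr _ => -1
  map_one' := rfl
  map_mul' := by rintro (i | i) (j | j) <;> rfl

/-- The integer `i` such that the given element of `D∞` is `r i` or `sr i`. -/
def coord : DihedralGroup 0 → ℤ
  | r i => i
  | sr i => i

@[simp] lemma sign_r (i : ZMod 0) : sign (r i) = 1 := rfl

@[simp] lemma sign_sr (i : ZMod 0) : sign (sr i) = -1 := rfl

@[simp] lemma coord_r (i : ZMod 0) : coord (r i) = i := rfl

@[simp] lemma coord_sr (i : ZMod 0) : coord (sr i) = i := rfl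

@[simp] lemma coord_one : coord 1 = 0 := rfl

lemma ext_sign_coord {g h : DihedralGroup 0} (hs : sign g = sign h) (hc : coord g = coord h) :
    g = h := by
  have hne : (1 : ℤˣ) ≠ -1 := by decide
  rcases g with i | i <;> rcases h with j | j
  · exact congrArg r hc
  · exact absurd hs hne
  · exact absurd hs.symm hne
  · exact congrArg sr hc

lemma coord_mul (g h : DihedralGroup 0) : coord (g * h) = coord h + sign h * coord g := by
  rcases g with (i : ℤ) | (i : ℤ) <;> rcases h with (j : ℤ) | (j : ℤ)
  · change i + j = j + ((1 : ℤˣ) : ℤ) * i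
    push_cast; ring
  · change j - i = j + ((-1 : ℤˣ) : ℤ) * i
    push_cast; ring
  · change i + j = j + ((1 : ℤˣ) : ℤ) * i
    push_cast; ring
  · change j - i = j + ((-1 : ℤˣ) : ℤ) * i
    push_cast; ring

lemma coord_inv (g : DihedralGroup 0) : coord g⁻¹ = -(sign g * coord g) := by
  have h := coord_mul g⁻¹ g
  rw [inv_mul_cancel, coord_one] at h
  rcases Int.units_eq_one_or (sign g) with hs | hs <;> rw [hs] at h ⊢ <;> push_cast at h ⊢ <;>
    linarith

lemma coord_pow {g : DihedralGroup 0} (hg : sign g = 1) (k : ℕ) : coord (g ^ k) = k * coord g := by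
  induction k with
  | zero => simp
  | succ k ih => rw [pow_succ, coord_mul, ih, hg]; push_cast; ring

lemma sign_sq (g : DihedralGroup 0) : sign (g ^ 2) = 1 := by
  rw [map_pow, sq, Int.units_mul_self]

lemma sq_eq_one_of_sign {g : DihedralGroup 0} (hg : sign g = -1) : g ^ 2 = 1 := by
  refine ext_sign_coord (by rw [sign_sq, map_one]) ?_
  rw [sq, coord_mul, hg, coord_one]; push_cast; ring

/-- The endomorphism of `D∞` that fixes rotations and shifts reflections by `c`. -/
def shift (c : ℤ) : DihedralGroup 0 →* DihedralGroup 0 where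
  toFun
    | r i => r i
    | sr i => sr (show ℤ from (show ℤ from i) + c)
  map_one' := rfl
  map_mul' := by
    rintro ((i : ℤ) | (i : ℤ)) ((j : ℤ) | (j : ℤ))
    · rfl
    · exact congrArg sr (show j - i + c = j + c - i by ring)
    · exact congrArg sr (show i + j + c = i + c + j by ring)
    · exact congrArg r (show j - i = j + c - (i + c) by ring)

/-- An element of a finitely generated abelian group that is not mapped to `1` by any
homomorphism to `ℤ` is a proper multiple modulo torsion. -/
lemma exists_dual_eq_one_or_torsion {Q : Type*} [AddCommGroup Q] [Module.Finite ℤ Q] (a : Q) :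
    (∃ ψ : Q →ₗ[ℤ] ℤ, ψ a = 1) ∨
      ∃ (N : ℕ) (d : ℤ) (q : Q), 0 < N ∧ ¬ IsUnit d ∧ N • (a - d • q) = 0 := by
  obtain ⟨d, hd⟩ := (IsPrincipalIdealRing.principal
    (LinearMap.range (Module.Dual.eval ℤ Q a))).principal
  by_cases hu : IsUnit d
  · left
    have h1 : (1 : ℤ) ∈ LinearMap.range (Module.Dual.eval ℤ Q a) := by
      rw [hd]
      exact Ideal.mem_span_singleton.2 hu.dvd
    exact h1
  · right
    have hdvd (ψ : Q →ₗ[ℤ] ℤ) : d ∣ ψ a := by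
      have h1 : ψ a ∈ LinearMap.range (Module.Dual.eval ℤ Q a) := ⟨ψ, rfl⟩
      rw [hd] at h1
      exact Ideal.mem_span_singleton.1 h1
    let T := Submodule.torsion ℤ Q
    have : Module.Free ℤ (Q ⧸ T) := inferInstance
    let b := Module.Free.chooseBasis ℤ (Q ⧸ T)
    choose c hc using fun i => hdvd ((b.coord i).comp T.mkQ)
    obtain ⟨q, hq⟩ := T.mkQ_surjective (∑ i, c i • b i)
    have ha : T.mkQ (a - d • q) = 0 := by
      rw [map_sub, map_smul, hq, sub_eq_zero, Finset.smul_sum, ← b.sum_repr (T.mkQ a)]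
      refine Finset.sum_congr rfl fun i _ => ?_
      rw [smul_smul, ← hc i]
      rfl
    rw [Submodule.mkQ_apply, Submodule.Quotient.mk_eq_zero, Submodule.mem_torsion_iff] at ha
    obtain ⟨⟨n, hn⟩, hnq⟩ := ha
    have hn0 : n ≠ 0 := nonZeroDivisors.ne_zero hn
    refine ⟨n.natAbs, d, q, Int.natAbs_pos.2 hn0, hu, ?_⟩
    have hz : n • (a - d • q) = 0 := hnq
    rw [← natCast_zsmul]
    rcases Int.natAbs_eq n with h | h
    · rw [← h, hz]
    · rw [← neg_eq_zero, ← neg_zsmul, ← h, hz]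

section Words

variable {ι : Type*}

/-- The signs of the images of the free generators under a homomorphism to `D∞`. -/
def pattern (φ : FreeGroup ι →* DihedralGroup 0) : ι → ℤˣ :=
  fun i => sign (φ (FreeGroup.of i))

/-- The coordinates of the images of the free generators under a homomorphism to `D∞`. -/
def coords (φ : FreeGroup ι →* DihedralGroup 0) : ι → ℤ :=
  fun i => coord (φ (FreeGroup.of i))

lemma sign_apply (φ : FreeGroup ι →* DihedralGroup 0) (w : FreeGroup ι) :
    sign (φ w) = FreeGroup.lift (pattern φ) w := by
  have h : sign.comp φ = FreeGroup.lift (pattern φ) := by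
    ext i
    simp [pattern]
  exact DFunLike.congr_fun h w

/-- The value of `aᴺ ρ` under `φ` is a rotation by a multiple of `N` whose quotient by `N` is
not a unit, as are the values of the two factors. -/
def Obstructs (φ : FreeGroup ι →* DihedralGroup 0) (a : ι) (N : ℕ) (ρ : FreeGroup ι) : Prop :=
  sign (φ (FreeGroup.of a ^ N)) = 1 ∧ sign (φ ρ) = 1 ∧
    ∃ s : ℤ, ¬ IsUnit s ∧ coord (φ (FreeGroup.of a ^ N)) + coord (φ ρ) = N * s

lemma Obstructs.pow {φ : FreeGroup ι →* DihedralGroup 0} {a : ι} {N : ℕ} {ρ : FreeGroup ι}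
    (h : Obstructs φ a N ρ) (k : ℕ) : Obstructs φ a (N * k) (ρ ^ k) := by
  obtain ⟨h1, h2, s, hs, h3⟩ := h
  refine ⟨by rw [pow_mul, map_pow, map_pow, h1, one_pow], by rw [map_pow, map_pow, h2, one_pow],
    s, hs, ?_⟩
  rw [pow_mul, map_pow φ _ k, map_pow φ _ k, coord_pow h1, coord_pow h2, ← mul_add, h3]
  push_cast; ring

lemma Obstructs.ne {φ : FreeGroup ι →* DihedralGroup 0} {a : ι} {N : ℕ} {ρ : FreeGroup ι}
    (h : Obstructs φ a N ρ) (hN : 0 < N) : φ (FreeGroup.of a ^ N * ρ) ≠ r (N : ZMod 0) := by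
  obtain ⟨-, h2, s, hs, h3⟩ := h
  intro heq
  have h4 := congrArg coord heq
  have hcast : coord (r (N : ZMod 0)) = (N : ℤ) := rfl
  rw [map_mul, coord_mul, h2, hcast, Units.val_one, one_mul, add_comm, h3] at h4
  have hN' : (N : ℤ) ≠ 0 := by exact_mod_cast hN.ne'
  exact hs ((mul_eq_left₀ hN').1 h4 ▸ isUnit_one)

/-- A word with rotation values can be modified, inside a normal subgroup, so that its value
is multiplied by a factor that detects the signs of the images of the generators. -/
lemma exists_coord_eq_mul_prod [DecidableEq ι] {R : Subgroup (FreeGroup ι)} [R.Normal]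
    (δ : ι → ℤˣ) {w : FreeGroup ι} (hw : w ∈ R)
    (hs : ∀ φ : FreeGroup ι →* DihedralGroup 0, sign (φ w) = 1) (T : Finset ι) :
    ∃ ρ ∈ R, ∀ φ : FreeGroup ι →* DihedralGroup 0, sign (φ ρ) = 1 ∧
      coord (φ ρ) = coord (φ w) * ∏ i ∈ T, (1 + (δ i : ℤ) * pattern φ i) := by
  induction T using Finset.induction_on with
  | empty => exact ⟨w, hw, fun φ => ⟨hs φ, by simp⟩⟩
  | insert i T hi ih =>
    obtain ⟨ρ, hρ, h⟩ := ih
    refine ⟨ρ * (FreeGroup.of i * ρ ^ (δ i : ℤ) * (FreeGroup.of i)⁻¹),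
      mul_mem hρ (‹R.Normal›.conj_mem _ (zpow_mem hρ _) _), fun φ => ?_⟩
    obtain ⟨h1, h2⟩ := h φ
    rw [Finset.prod_insert hi]
    constructor
    · simp [h1]
    · have hp : sign (φ (FreeGroup.of i)) = pattern φ i := rfl
      have hz : coord (φ ρ ^ (δ i : ℤ)) = δ i * coord (φ ρ) := by
        rcases Int.units_eq_one_or (δ i) with hd | hd <;> simp [hd, coord_inv, h1]
      simp only [map_mul, map_inv, map_zpow, coord_mul, coord_inv, hz, h1, hp, one_zpow,
        mul_one, mul_inv_cancel]
      rw [h2]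
      rcases Int.units_eq_one_or (pattern φ i) with hd | hd <;> rw [hd] <;> push_cast <;> simp <;>
        ring

lemma prod_one_add_mul [Fintype ι] (δ ε : ι → ℤˣ) :
    ∏ i, (1 + (δ i : ℤ) * ε i) = if ε = δ then 2 ^ Fintype.card ι else 0 := by
  split_ifs with h
  · subst h
    rw [← Finset.card_univ]
    refine Finset.prod_eq_pow_card fun i _ => ?_
    rcases Int.units_eq_one_or (ε i) with hd | hd <;> rw [hd] <;> rfl
  · obtain ⟨i, hi⟩ := Function.ne_iff.1 h
    refine Finset.prod_eq_zero (Finset.mem_univ i) ?_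
    rcases Int.units_eq_one_or (ε i) with h1 | h1 <;>
      rcases Int.units_eq_one_or (δ i) with h2 | h2 <;> rw [h1, h2] at hi ⊢ <;> simp at hi ⊢

variable [Fintype ι] [DecidableEq ι]

/-- For homomorphisms with a given sign pattern, the coordinate of the image of a word is a
linear form in the coordinates of the images of the generators. -/
lemma exists_coord_eq_dotProduct (δ : ι → ℤˣ) (w : FreeGroup ι) :
    ∃ v : ι → ℤ, ∀ φ : FreeGroup ι →* DihedralGroup 0, pattern φ = δ →
      coord (φ w) = v ⬝ᵥ coords φ := by
  induction w using FreeGroup.induction_on with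
  | C1 => exact ⟨0, fun φ _ => by simp⟩
  | of i => exact ⟨Pi.single i 1, fun φ _ => by simp [coords]⟩
  | inv_of i h =>
    obtain ⟨v, hv⟩ := h
    refine ⟨-((δ i : ℤ) • v), fun φ hφ => ?_⟩
    rw [map_inv, coord_inv, hv φ hφ, neg_dotProduct, smul_dotProduct, smul_eq_mul, ← hφ]
    rfl
  | mul x y hx hy =>
    obtain ⟨u, hu⟩ := hx
    obtain ⟨v, hv⟩ := hy
    refine ⟨v + ((FreeGroup.lift δ y : ℤˣ) : ℤ) • u, fun φ hφ => ?_⟩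
    rw [map_mul, coord_mul, hu φ hφ, hv φ hφ, sign_apply, hφ, add_dotProduct, smul_dotProduct,
      smul_eq_mul]

/-- The linear forms `v` such that, for some word in `R`, its value is the rotation by a fixed
multiple of `v` for homomorphisms with sign pattern `δ`, and is trivial for all others. -/
def forms (R : Subgroup (FreeGroup ι)) (δ : ι → ℤˣ) : AddSubgroup (ι → ℤ) where
  carrier := {v | ∃ ρ ∈ R, ∀ φ : FreeGroup ι →* DihedralGroup 0, sign (φ ρ) = 1 ∧
    coord (φ ρ) = if pattern φ = δ then 2 ^ (Fintype.card ι + 1) * (v ⬝ᵥ coords φ) else 0}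
  zero_mem' := ⟨1, one_mem _, fun φ => by simp⟩
  add_mem' := by
    rintro u v ⟨x, hx, h⟩ ⟨y, hy, h'⟩
    refine ⟨x * y, mul_mem hx hy, fun φ => ?_⟩
    rw [map_mul, coord_mul, map_mul, (h φ).1, (h' φ).1, (h φ).2, (h' φ).2, add_dotProduct]
    refine ⟨rfl, ?_⟩
    split_ifs <;> simp [mul_add, add_comm]
  neg_mem' := by
    rintro u ⟨x, hx, h⟩
    refine ⟨x⁻¹, inv_mem hx, fun φ => ?_⟩
    rw [map_inv, coord_inv, map_inv, (h φ).1, (h φ).2, neg_dotProduct]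
    refine ⟨inv_one, ?_⟩
    split_ifs <;> simp

lemma mem_forms {R : Subgroup (FreeGroup ι)} [R.Normal] {δ : ι → ℤˣ} {w : FreeGroup ι}
    (hw : w ∈ R) (hδ : FreeGroup.lift δ w = 1) {v : ι → ℤ}
    (hv : ∀ φ : FreeGroup ι →* DihedralGroup 0, pattern φ = δ → coord (φ w) = v ⬝ᵥ coords φ) :
    v ∈ forms R δ := by
  obtain ⟨ρ, hρ, h⟩ := exists_coord_eq_mul_prod δ (pow_mem hw 2)
    (fun φ => by rw [map_pow, sign_sq]) Finset.univ
  refine ⟨ρ, hρ, fun φ => ⟨(h φ).1, ?_⟩⟩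
  rw [(h φ).2, prod_one_add_mul]
  split_ifs with hp
  · rw [map_pow, coord_pow (by rw [sign_apply, hp, hδ]), hv φ hp]
    push_cast; ring
  · simp

/-- A homomorphism that respects every linear form in `forms R δ` and sends a generator to the
standard rotation is trivial on `R`. -/
lemma exists_hom_of_dual {R : Subgroup (FreeGroup ι)} [R.Normal] {δ : ι → ℤˣ} {a : ι}
    (ha : δ a = 1) {c : ι → ℤ} (hc : ∀ v ∈ forms R δ, v ⬝ᵥ c = 0) (hca : c a = 1) :
    ∃ φ : FreeGroup ι →* DihedralGroup 0, R ≤ φ.ker ∧ φ (FreeGroup.of a) = r 1 := by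
  let φ : FreeGroup ι →* DihedralGroup 0 :=
    FreeGroup.lift fun i => if δ i = 1 then r (c i : ℤ) else sr (c i : ℤ)
  have hof (i : ι) : φ (FreeGroup.of i) = if δ i = 1 then r (c i : ℤ) else sr (c i : ℤ) :=
    FreeGroup.lift_apply_of
  have hp : pattern φ = δ := by
    funext i
    rw [pattern, hof]
    rcases Int.units_eq_one_or (δ i) with hd | hd <;> rw [hd] <;> rfl
  have hcφ : coords φ = c := by
    funext i
    rw [coords, hof]
    split_ifs <;> rfl
  have hφa : φ (FreeGroup.of a) = r 1 := by
    rw [hof, if_pos ha, hca]; rfl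
  have hpos (w : FreeGroup ι) (hw : w ∈ R) (hs : FreeGroup.lift δ w = 1) : φ w = 1 := by
    obtain ⟨v, hv⟩ := exists_coord_eq_dotProduct δ w
    refine ext_sign_coord (by rw [sign_apply, hp, hs, map_one]) ?_
    rw [hv φ hp, hcφ, hc v (mem_forms hw hs hv), coord_one]
  refine ⟨φ, fun w hw => ?_, hφa⟩
  rcases Int.units_eq_one_or (FreeGroup.lift δ w) with hs | hs
  · exact hpos w hw hs
  · exfalso
    have hcomm : w * (FreeGroup.of a * w⁻¹ * (FreeGroup.of a)⁻¹) ∈ R :=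
      mul_mem hw (‹R.Normal›.conj_mem _ (inv_mem hw) _)
    have h1 := congrArg coord (hpos _ hcomm (by simp [ha]))
    have h2 : sign (φ w) = -1 := by rw [sign_apply, hp, hs]
    have h3 : sign (φ (FreeGroup.of a)) = 1 := by rw [hφa]; rfl
    have h4 : coord (φ (FreeGroup.of a)) = 1 := by rw [hφa]; rfl
    simp only [map_mul, map_inv, coord_mul, coord_inv, h2, h3, h4, coord_one] at h1
    norm_num at h1
    omega

lemma exists_hom_or_obstructs_pattern (R : Subgroup (FreeGroup ι)) [R.Normal] (a : ι)
    (δ : ι → ℤˣ) :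
    (∃ φ : FreeGroup ι →* DihedralGroup 0, R ≤ φ.ker ∧ φ (FreeGroup.of a) = r 1) ∨
      ∃ N : ℕ, 0 < N ∧ ∃ ρ ∈ R, ∀ φ : FreeGroup ι →* DihedralGroup 0,
        (pattern φ = δ → Obstructs φ a N ρ) ∧ (pattern φ ≠ δ → φ ρ = 1) := by
  rcases Int.units_eq_one_or (δ a) with ha | ha
  swap
  · refine Or.inr ⟨2, two_pos, 1, one_mem _, fun φ => ⟨fun hp => ?_, fun _ => map_one φ⟩⟩
    have h : φ (FreeGroup.of a ^ 2) = 1 := by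
      rw [map_pow]
      exact sq_eq_one_of_sign ((congrFun hp a).trans ha)
    exact ⟨by rw [h, map_one], by rw [map_one, map_one], 0, not_isUnit_zero, by simp [h]⟩
  let S := (forms R δ).toIntSubmodule
  rcases exists_dual_eq_one_or_torsion (S.mkQ (Pi.single a 1)) with ⟨ψ, hψ⟩ | ⟨N, d, q, hN, hd, h⟩
  · refine Or.inl (exists_hom_of_dual ha (c := fun i => ψ (S.mkQ (Pi.single i 1))) ?_ hψ)
    intro v hv
    have h1 : (ψ.comp S.mkQ) v = 0 := by
      have h0 : S.mkQ v = 0 := (Submodule.Quotient.mk_eq_zero S).2 hv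
      rw [LinearMap.comp_apply, h0, map_zero]
    rw [LinearMap.pi_apply_eq_sum_univ] at h1
    simpa [dotProduct, ← Pi.single_apply, Pi.single_comm, eq_comm] using h1
  · obtain ⟨q, rfl⟩ := S.mkQ_surjective q
    rw [← map_smul, ← map_sub, ← map_nsmul] at h
    have hmem : N • (Pi.single a 1 - d • q) ∈ forms R δ := (Submodule.Quotient.mk_eq_zero S).1 h
    obtain ⟨ρ, hρ, h⟩ := neg_mem hmem
    refine Or.inr ⟨2 ^ (Fintype.card ι + 1) * N, by positivity, ρ, hρ, fun φ => ⟨fun hp => ?_,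
      fun hp => ext_sign_coord ((h φ).1.trans (map_one _).symm) ?_⟩⟩
    · have hs : sign (φ (FreeGroup.of a)) = 1 := (congrFun hp a).trans ha
      refine ⟨by rw [map_pow, map_pow, hs, one_pow], (h φ).1, d * (q ⬝ᵥ coords φ),
        fun hu => hd (isUnit_of_mul_isUnit_left hu), ?_⟩
      rw [(h φ).2, if_pos hp, map_pow, coord_pow hs]
      simp only [neg_dotProduct, smul_dotProduct, sub_dotProduct, single_dotProduct, coords]
      simp only [nsmul_eq_mul, smul_eq_mul]
      push_cast
      ring
    · rw [(h φ).2, if_neg hp, coord_one]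

lemma exists_hom_or_obstructs (R : Subgroup (FreeGroup ι)) [R.Normal] (a : ι) :
    (∃ φ : FreeGroup ι →* DihedralGroup 0, R ≤ φ.ker ∧ φ (FreeGroup.of a) = r 1) ∨
      ∃ N : ℕ, 0 < N ∧ ∃ ρ ∈ R, ∀ φ : FreeGroup ι →* DihedralGroup 0, Obstructs φ a N ρ := by
  refine or_iff_not_imp_left.2 fun hno => ?_
  suffices H : ∀ T : Finset (ι → ℤˣ), ∃ N : ℕ, 0 < N ∧ ∃ ρ ∈ R,
      ∀ φ : FreeGroup ι →* DihedralGroup 0,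
        (pattern φ ∈ T → Obstructs φ a N ρ) ∧ (pattern φ ∉ T → φ ρ = 1) by
    obtain ⟨N, hN, ρ, hρ, h⟩ := H Finset.univ
    exact ⟨N, hN, ρ, hρ, fun φ => (h φ).1 (Finset.mem_univ _)⟩
  intro T
  induction T using Finset.induction_on with
  | empty => exact ⟨1, one_pos, 1, one_mem _, fun φ => by simp⟩
  | insert δ T hδ ih =>
    obtain ⟨N, hN, ρ, hρ, h⟩ := ih
    obtain ⟨N', hN', ρ', hρ', h'⟩ :=
      (exists_hom_or_obstructs_pattern R a δ).resolve_left hno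
    refine ⟨N * N', mul_pos hN hN', ρ ^ N' * ρ' ^ N, mul_mem (pow_mem hρ _) (pow_mem hρ' _),
      fun φ => ⟨fun hp => ?_, fun hp => ?_⟩⟩
    · by_cases hpδ : pattern φ = δ
      · have h1 : φ ρ = 1 := (h φ).2 (hpδ ▸ hδ)
        have h2 := ((h' φ).1 hpδ).pow N
        rw [mul_comm N' N] at h2
        simpa [Obstructs, h1] using h2
      · have h1 : φ ρ' = 1 := (h' φ).2 hpδ
        have h2 := ((h φ).1 ((Finset.mem_insert.1 hp).resolve_left hpδ)).pow N'
        simpa [Obstructs, h1] using h2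
    · rw [Finset.mem_insert, not_or] at hp
      simp [(h φ).2 hp.2, (h' φ).2 hp.1]

end Words

/-- If the copy of `D∞` is verbally closed, then a homomorphism from a free group whose image
contains its standard generators factors, on its image, through a retraction onto `D∞`. -/
lemma exists_retraction {G : Type*} [Group G] {f : DihedralGroup 0 →* G}
    (hf : Function.Injective f) (hv : VerballyClosedIn G f.range) {k : ℕ}
    (θ : FreeGroup (Fin k) →* G) {a b : Fin k} (ha : θ (FreeGroup.of a) = f (r 1))
    (hb : θ (FreeGroup.of b) = f (sr 0)) :
    ∃ φ : FreeGroup (Fin k) →* DihedralGroup 0, θ.ker ≤ φ.ker ∧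
      φ (FreeGroup.of a) = r 1 ∧ φ (FreeGroup.of b) = sr 0 := by
  rcases exists_hom_or_obstructs θ.ker a with ⟨φ, hφ, hφa⟩ | ⟨N, hN, ρ, hρ, h⟩
  · have hb2 : φ (FreeGroup.of b ^ 2) = 1 := hφ (by
      rw [MonoidHom.mem_ker, map_pow, hb, ← map_pow, sq_eq_one_of_sign rfl, map_one])
    have hba2 : φ ((FreeGroup.of b * FreeGroup.of a) ^ 2) = 1 := hφ (by
      rw [MonoidHom.mem_ker, map_pow, map_mul, ha, hb, ← map_mul, ← map_pow,
        sq_eq_one_of_sign rfl, map_one])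
    rcases hc : φ (FreeGroup.of b) with j | j
    · exfalso
      rw [map_pow, hc] at hb2
      rw [map_pow, map_mul, hc, hφa] at hba2
      have h1 := congrArg coord hb2
      have h2 := congrArg coord hba2
      rw [coord_pow rfl, coord_one] at h1 h2
      rw [coord_mul] at h2
      have h3 : coord (r 1) = 1 := rfl
      rw [h3, sign_r] at h2
      push_cast at h1 h2
      omega
    · refine ⟨(shift (-(show ℤ from j))).comp φ, fun w hw => ?_, ?_, ?_⟩
      · rw [MonoidHom.mem_ker, MonoidHom.comp_apply, hφ hw, map_one]
      · rw [MonoidHom.comp_apply, hφa]; rfl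
      · rw [MonoidHom.comp_apply, hc]
        exact congrArg sr (add_neg_cancel (show ℤ from j))
  · exfalso
    have hsol : FreeGroup.lift (fun i => θ (FreeGroup.of i)) (FreeGroup.of a ^ N * ρ) =
        f (r (N : ZMod 0)) := by
      have hθ : FreeGroup.lift (fun i => θ (FreeGroup.of i)) = θ := by ext; simp
      rw [hθ, map_mul, hρ, mul_one, map_pow, ha, ← map_pow, r_one_pow]
    obtain ⟨x, hx, hxw⟩ := hv k _ _ ⟨_, rfl⟩ ⟨_, hsol⟩
    choose y hy using hx
    have hlift : FreeGroup.lift x = f.comp (FreeGroup.lift y) := by ext i; simp [hy]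
    rw [hlift] at hxw
    exact (h (FreeGroup.lift y)).ne hN (hf hxw)

lemma closure_r_sr : Subgroup.closure {(r 1 : DihedralGroup 0), sr 0} = ⊤ := by
  have hr (i : ZMod 0) : r i ∈ Subgroup.closure {(r 1 : DihedralGroup 0), sr 0} := by
    have h : (r i : DihedralGroup 0) = r 1 ^ (show ℤ from i) := by
      rw [r_one_zpow]; rfl
    rw [h]
    exact zpow_mem (Subgroup.subset_closure (by simp)) _
  refine eq_top_iff.2 ?_
  rintro (i | i) -
  · exact hr i
  · have h : (sr i : DihedralGroup 0) = sr 0 * r i := by simp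
    rw [h]
    exact mul_mem (Subgroup.subset_closure (by simp)) (hr i)

end InfiniteDihedral

open DihedralGroup InfiniteDihedral in
/-- The infinite dihedral group is strongly verbally closed. -/
theorem infiniteDihedral_stronglyVerballyClosed :
    StronglyVerballyClosed (DihedralGroup 0) := by
  intro G _ f hf hv n m w ⟨g, hg⟩
  let π : FreeGroup (Fin (n + 2)) →* Monoid.Coprod f.range (FreeGroup (Fin n)) :=
    FreeGroup.lift (Fin.cons (Monoid.Coprod.inl (f.rangeRestrict (r 1)))
      (Fin.cons (Monoid.Coprod.inl (f.rangeRestrict (sr 0)))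
        fun i => Monoid.Coprod.inr (FreeGroup.of i)))
  have hπ0 : π (FreeGroup.of 0) = Monoid.Coprod.inl (f.rangeRestrict (r 1)) := by simp [π]
  have hπ1 : π (FreeGroup.of 1) = Monoid.Coprod.inl (f.rangeRestrict (sr 0)) := by
    rw [← Fin.succ_zero_eq_one]; simp [π]
  have hπi (i : Fin n) : π (FreeGroup.of i.succ.succ) = Monoid.Coprod.inr (FreeGroup.of i) := by
    simp [π]
  have hsurj : π.range = ⊤ := by
    let inlH : DihedralGroup 0 →* Monoid.Coprod f.range (FreeGroup (Fin n)) :=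
      Monoid.Coprod.inl.comp f.rangeRestrict
    have hl : inlH.range ≤ π.range := by
      rw [MonoidHom.range_eq_map inlH, ← closure_r_sr, MonoidHom.map_closure, Subgroup.closure_le]
      rintro _ ⟨x, rfl | rfl, rfl⟩
      · exact ⟨_, hπ0⟩
      · exact ⟨_, hπ1⟩
    rw [eq_top_iff, ← Monoid.Coprod.range_inl_sup_range_inr, sup_le_iff]
    constructor
    · rintro _ ⟨⟨_, x, rfl⟩, rfl⟩
      exact hl ⟨x, rfl⟩
    · let inrF : FreeGroup (Fin n) →* Monoid.Coprod f.range (FreeGroup (Fin n)) :=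
        Monoid.Coprod.inr
      change inrF.range ≤ π.range
      rw [MonoidHom.range_eq_map inrF, ← FreeGroup.closure_range_of, MonoidHom.map_closure,
        Subgroup.closure_le]
      rintro _ ⟨_, ⟨i, rfl⟩, rfl⟩
      exact ⟨_, hπi i⟩
  let Φ := (Monoid.Coprod.lift f.range.subtype (FreeGroup.lift g)).comp π
  obtain ⟨φ, hφ, hφ0, hφ1⟩ := exists_retraction hf hv Φ (a := 0) (b := 1)
    (by simp [Φ, hπ0]) (by simp [Φ, hπ1])
  refine ⟨fun i => f (φ (FreeGroup.of i.succ.succ)), fun i => ⟨_, rfl⟩, fun i => ?_⟩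
  have hcomp : (Monoid.Coprod.lift f.range.subtype (FreeGroup.lift
      fun i => f (φ (FreeGroup.of i.succ.succ)))).comp π = f.comp φ := by
    ext j
    refine Fin.cases ?_ (fun j => Fin.cases ?_ (fun j => ?_) j) j
    · simp [hπ0, hφ0]
    · simp [hπ1, hφ1]
    · simp [hπi]
  obtain ⟨u, hu⟩ : w i ∈ π.range := hsurj ▸ Subgroup.mem_top _
  have hker : u ∈ φ.ker := hφ (by
    rw [MonoidHom.mem_ker, MonoidHom.comp_apply, hu, hg i])
  rw [← hu, ← MonoidHom.comp_apply, hcomp, MonoidHom.comp_apply, hker, map_one]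
end

section
/- An equationally Noetherian subgroup H of a group G is algebraically closed in G if and only if H is a retract of every subgroup of G that is finitely generated over H. -/
/-- A group `H` is equationally Noetherian if every system of equations over `H` in
finitely many unknowns (a set of elements of `H ∗ F(x₁,…,xₙ)`) is equivalent to some
finite subsystem. -/
def EquationallyNoetherian (H : Type*) [Group H] : Prop :=
  ∀ (n : ℕ) (S : Set (Monoid.Coprod H (FreeGroup (Fin n)))),
    ∃ S₀ : Finset (Monoid.Coprod H (FreeGroup (Fin n))), (S₀ : Set _) ⊆ S ∧
      ∀ x : Fin n → H,
        (∀ w ∈ S₀, Monoid.Coprod.lift (MonoidHom.id H) (FreeGroup.lift x) w = 1) ↔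
        (∀ w ∈ S, Monoid.Coprod.lift (MonoidHom.id H) (FreeGroup.lift x) w = 1)

namespace Monoid.Coprod

variable {G : Type*} [Group G] {H : Subgroup G} {ι : Type*}

theorem range_lift_subtype_freeGroupLift (g : ι → G) :
    (lift H.subtype (FreeGroup.lift g)).range = H ⊔ Subgroup.closure (Set.range g) := by
  rw [range_lift, Subgroup.range_subtype, FreeGroup.range_lift_eq_closure]

theorem coe_lift_id_freeGroupLift (x : ι → H) (w : Monoid.Coprod H (FreeGroup ι)) :
    ((lift (MonoidHom.id H) (FreeGroup.lift x) w : H) : G) =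
      lift H.subtype (FreeGroup.lift fun j => (x j : G)) w := by
  have h : H.subtype.comp (lift (MonoidHom.id H) (FreeGroup.lift x)) =
      lift H.subtype (FreeGroup.lift fun j => (x j : G)) := by
    ext <;> simp
  exact DFunLike.congr_fun h w

end Monoid.Coprod

open Monoid.Coprod

/-- Over an equationally Noetherian, algebraically closed subgroup, an arbitrary system of
equations solvable in `G` is solvable in the subgroup. -/
theorem AlgebraicallyClosedIn.exists_solution {G : Type*} [Group G] {H : Subgroup G}
    (hAC : AlgebraicallyClosedIn G H) (hEN : EquationallyNoetherian H) {n : ℕ}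
    (S : Set (Monoid.Coprod H (FreeGroup (Fin n)))) (g : Fin n → G)
    (hg : ∀ w ∈ S, lift H.subtype (FreeGroup.lift g) w = 1) :
    ∃ x : Fin n → H, ∀ w ∈ S, lift (MonoidHom.id H) (FreeGroup.lift x) w = 1 := by
  obtain ⟨S₀, hS₀, hequiv⟩ := hEN n S
  obtain ⟨x, hxH, hx⟩ := hAC n S₀.card (fun i => S₀.equivFin.symm i)
    ⟨g, fun i => hg _ (hS₀ (S₀.equivFin.symm i).2)⟩
  refine ⟨fun j => ⟨x j, hxH j⟩, (hequiv _).1 fun w hw => Subtype.ext ?_⟩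
  rw [coe_lift_id_freeGroupLift]
  simpa using hx (S₀.equivFin ⟨w, hw⟩)

theorem AlgebraicallyClosedIn.exists_retraction {G : Type*} [Group G] {H : Subgroup G}
    (hAC : AlgebraicallyClosedIn G H) (hEN : EquationallyNoetherian H) {K : Subgroup G}
    {X : Finset G} (hK : K = H ⊔ Subgroup.closure (X : Set G)) :
    ∃ ρ : K →* G, (∀ x : K, ρ x ∈ H) ∧ ∀ x : K, (x : G) ∈ H → ρ x = x := by
  let g : Fin X.card → G := fun i => X.equivFin.symm i
  let φ := lift H.subtype (FreeGroup.lift g)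
  have hrange : Set.range g = X :=
    (X.equivFin.symm.surjective.range_comp Subtype.val).trans Subtype.range_coe
  obtain rfl : K = φ.range := by
    rw [hK, range_lift_subtype_freeGroupLift, hrange]
  obtain ⟨x, hx⟩ := hAC.exists_solution hEN (φ.ker : Set _) g fun w hw => hw
  let ψ := lift (MonoidHom.id H) (FreeGroup.lift x)
  have hker : φ.rangeRestrict.ker ≤ ψ.ker := by
    rw [MonoidHom.ker_rangeRestrict]
    exact hx
  let ρ := φ.rangeRestrict.liftOfSurjective φ.rangeRestrict_surjective ⟨ψ, hker⟩
  refine ⟨H.subtype.comp ρ, fun k => (ρ k).2, fun k hk => ?_⟩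
  have hinl : k = φ.rangeRestrict (inl ⟨k, hk⟩) := Subtype.ext (by simp [φ])
  have hρ : ρ (φ.rangeRestrict (inl ⟨k, hk⟩)) = ψ (inl ⟨k, hk⟩) :=
    MonoidHom.liftOfRightInverse_comp_apply _ _ _ ⟨ψ, hker⟩ _
  rw [← hinl] at hρ
  simp [hρ, ψ]

theorem algebraicallyClosedIn_of_exists_retraction {G : Type*} [Group G] {H : Subgroup G}
    (hH : ∀ K : Subgroup G, H ≤ K →
      (∃ X : Finset G, K = H ⊔ Subgroup.closure (X : Set G)) →
      ∃ ρ : K →* G, (∀ x : K, ρ x ∈ H) ∧ ∀ x : K, (x : G) ∈ H → ρ x = x) :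
    AlgebraicallyClosedIn G H := by
  classical
  rintro n m w ⟨g, hg⟩
  let φ := lift H.subtype (FreeGroup.lift g)
  have hφ : φ.range = H ⊔ Subgroup.closure (Set.range g) := range_lift_subtype_freeGroupLift g
  obtain ⟨ρ, hρH, hρ⟩ := hH φ.range (hφ ▸ le_sup_left) ⟨Finset.univ.image g, by simp [hφ]⟩
  refine ⟨fun j => ρ (φ.rangeRestrict (inr (FreeGroup.of j))), fun j => hρH _, fun i => ?_⟩
  have hcomp : lift H.subtype
      (FreeGroup.lift fun j => ρ (φ.rangeRestrict (inr (FreeGroup.of j)))) =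
      ρ.comp φ.rangeRestrict := by
    ext h
    · have hh : ((φ.rangeRestrict (inl h) : φ.range) : G) = h := by simp [φ]
      have hρh := hρ (φ.rangeRestrict (inl h)) (hh ▸ h.2)
      rw [hh] at hρh
      simpa using hρh.symm
    · simp
  have hone : φ.rangeRestrict (w i) = 1 := Subtype.ext (hg i)
  rw [hcomp, MonoidHom.comp_apply, hone, map_one]

/-- An equationally Noetherian subgroup `H` of a group `G` is algebraically closed in
`G` if and only if `H` is a retract of every subgroup of `G` finitely generated
over `H`. -/
theorem algebraicallyClosed_iff_retract_of_equationallyNoetherian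
    {G : Type*} [Group G] (H : Subgroup G)
    (hEN : EquationallyNoetherian H) :
    AlgebraicallyClosedIn G H ↔
      ∀ K : Subgroup G, H ≤ K →
        (∃ X : Finset G, K = H ⊔ Subgroup.closure (X : Set G)) →
        ∃ ρ : K →* G, (∀ x : K, ρ x ∈ H) ∧ ∀ x : K, (x : G) ∈ H → ρ x = x :=
  ⟨fun hAC _ _ ⟨_, hK⟩ => hAC.exists_retraction hEN hK,
    algebraicallyClosedIn_of_exists_retraction⟩
end

section
/- If V(G) is a verbal subgroup of a group G and H is a verbally closed subgroup of G, then the image of H under the natural homomorphism G → G/V(G) is a verbally closed subgroup of G/V(G). -/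
/-- The verbal subgroup of `G` determined by a family of words `W` (a set of elements
of the free group `F(x₁,…,xₙ)` for each arity `n`): the subgroup generated by all
values of the words of `W` in `G`. It is a normal subgroup of `G`. -/
def verbalSubgroup (G : Type*) [Group G] (W : ∀ n : ℕ, Set (FreeGroup (Fin n))) :
    Subgroup G :=
  Subgroup.closure {g : G | ∃ (n : ℕ) (w : FreeGroup (Fin n)),
    w ∈ W n ∧ ∃ x : Fin n → G, FreeGroup.lift x w = g}

theorem lift_map_castAdd_mul_map_natAdd {G : Type*} [Group G] {m n : ℕ}
    (u : FreeGroup (Fin m)) (v : FreeGroup (Fin n)) (x : Fin (m + n) → G) :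
    FreeGroup.lift x (FreeGroup.map (Fin.castAdd n) u * FreeGroup.map (Fin.natAdd m) v) =
      FreeGroup.lift (fun i => x (Fin.castAdd n i)) u *
        FreeGroup.lift (fun i => x (Fin.natAdd m i)) v := by
  have comp {k : ℕ} (f : Fin k → Fin (m + n)) (t : FreeGroup (Fin k)) :
      FreeGroup.lift x (FreeGroup.map f t) = FreeGroup.lift (fun i => x (f i)) t := by
    have : (FreeGroup.lift x).comp (FreeGroup.map f) = FreeGroup.lift (fun i => x (f i)) := by
      ext i
      simp
    exact DFunLike.congr_fun this t
  rw [map_mul, comp, comp]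

/-- Every element of a verbal subgroup is a value of a single word all of whose values lie in
that subgroup. -/
theorem exists_word_of_mem_verbalSubgroup {G : Type*} [Group G]
    {W : ∀ n : ℕ, Set (FreeGroup (Fin n))} {v : G} (hv : v ∈ verbalSubgroup G W) :
    ∃ (m : ℕ) (u : FreeGroup (Fin m)) (g : Fin m → G), FreeGroup.lift g u = v ∧
      ∀ x : Fin m → G, FreeGroup.lift x u ∈ verbalSubgroup G W := by
  induction hv using Subgroup.closure_induction with
  | mem v hv =>
    obtain ⟨n, w, hw, g, rfl⟩ := hv
    exact ⟨n, w, g, rfl, fun x => Subgroup.subset_closure ⟨n, w, hw, x, rfl⟩⟩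
  | one => exact ⟨0, 1, Fin.elim0, map_one _, fun x => by simp⟩
  | mul a b _ _ iha ihb =>
    obtain ⟨m, u, g, rfl, hu⟩ := iha
    obtain ⟨n, w, k, rfl, hw⟩ := ihb
    refine ⟨m + n, FreeGroup.map (Fin.castAdd n) u * FreeGroup.map (Fin.natAdd m) w,
      Fin.append g k, ?_, fun x => ?_⟩
    · simp only [lift_map_castAdd_mul_map_natAdd, Fin.append_left, Fin.append_right]
    · rw [lift_map_castAdd_mul_map_natAdd]
      exact mul_mem (hu _) (hw _)
  | inv a _ ih =>
    obtain ⟨m, u, g, rfl, hu⟩ := ih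
    exact ⟨m, u⁻¹, g, map_inv _ _, fun x => by simpa using hu x⟩

/-- If `H` is a verbally closed subgroup of `G` and `V(G)` is a verbal subgroup of
`G`, then the image of `H` in `G/V(G)` is verbally closed in `G/V(G)`. -/
theorem verballyClosed_image_quotient_verbalSubgroup
    {G : Type*} [Group G] (W : ∀ n : ℕ, Set (FreeGroup (Fin n)))
    (hN : (verbalSubgroup G W).Normal)
    (H : Subgroup G) (hvc : VerballyClosedIn G H) :
    VerballyClosedIn (G ⧸ verbalSubgroup G W)
      (H.map (QuotientGroup.mk' (verbalSubgroup G W))) := by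
  rintro n w _ ⟨h, hh, rfl⟩ ⟨q, hq⟩
  set π := QuotientGroup.mk' (verbalSubgroup G W)
  have lift_comp (f : Fin n → G) :
      FreeGroup.lift (fun i => π (f i)) w = π (FreeGroup.lift f w) := by
    have : FreeGroup.lift (fun i => π (f i)) = π.comp (FreeGroup.lift f) := by
      ext i
      simp
    exact DFunLike.congr_fun this w
  choose g hg using fun i => QuotientGroup.mk'_surjective (verbalSubgroup G W) (q i)
  obtain rfl : (fun i => π (g i)) = q := funext hg
  rw [lift_comp] at hq
  obtain ⟨m, u, k, hk, hu⟩ := exists_word_of_mem_verbalSubgroup (QuotientGroup.eq.mp hq)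
  obtain ⟨x, hxH, hx⟩ := hvc (n + m)
    (FreeGroup.map (Fin.castAdd m) w * FreeGroup.map (Fin.natAdd n) u) h hh
    ⟨Fin.append g k, by
      simp only [lift_map_castAdd_mul_map_natAdd, Fin.append_left, Fin.append_right, hk,
        mul_inv_cancel_left]⟩
  rw [lift_map_castAdd_mul_map_natAdd] at hx
  refine ⟨fun i => π (x (Fin.castAdd m i)),
    fun i => Subgroup.mem_map_of_mem π (hxH _), ?_⟩
  rw [lift_comp, ← hx]
  refine QuotientGroup.eq.mpr ?_
  rw [inv_mul_cancel_left]
  exact hu _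
end

section
/- An abelian subgroup H of a group G is verbally closed in G if and only if H ∩ [G,G] is trivial and the image of H in the abelianization G/[G,G] is a pure subgroup; moreover, under these conditions H is algebraically closed in G. -/
/-- A homomorphism from a finitely generated abelian group lifts along a surjection whose
kernel is pure. -/
theorem exists_addMonoidHom_lift_of_pure_ker {A C Q : Type*} [AddCommGroup A] [AddCommGroup C]
    [AddCommGroup Q] [AddGroup.FG Q] (k : A →+ C) (hk : Function.Surjective k)
    (hpure : ∀ (n : ℕ) (a : A), k (n • a) = 0 → ∃ p, k p = 0 ∧ n • p = n • a) (f : Q →+ C) :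
    ∃ s : Q →+ A, k.comp s = f := by
  obtain ⟨n, ι, _, p, _, e, ⟨φ⟩⟩ := AddCommGroup.equiv_free_prod_directSum_zmod Q
  let f' := f.comp φ.symm.toAddMonoidHom
  have hfree : ∃ s : (Fin n →₀ ℤ) →+ A, k.comp s = f'.comp (AddMonoidHom.inl _ _) := by
    choose a ha using fun i => hk (f' (Finsupp.single i 1, 0))
    refine ⟨Finsupp.liftAddHom fun i => zmultiplesHom A (a i), ?_⟩
    ext i
    simp [ha]
  have hcyc : ∀ (m : ℕ) (g : ZMod m →+ C), ∃ s : ZMod m →+ A, k.comp s = g := by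
    intro m g
    obtain ⟨a, ha⟩ := hk (g 1)
    obtain ⟨q, hq, hqa⟩ := hpure m a (by rw [map_nsmul, ha, ← map_nsmul]; simp)
    refine ⟨ZMod.lift m ⟨zmultiplesHom A (a - q), by simp [smul_sub, hqa]⟩, ?_⟩
    refine (AddMonoidHom.cancel_right (f := Int.castAddHom (ZMod m))
      (ZMod.ringHom_surjective (Int.castRingHom (ZMod m)))).1 ?_
    ext
    simpa [ha, hq] using congrArg k (ZMod.lift_coe m
      ⟨zmultiplesHom A (a - q), by simp [smul_sub, hqa]⟩ 1)
  classical
  choose t ht using fun i => hcyc (p i ^ e i)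
    ((f'.comp (AddMonoidHom.inr _ _)).comp (DirectSum.of (fun i => ZMod (p i ^ e i)) i))
  obtain ⟨s, hs⟩ := hfree
  have htors : k.comp (DirectSum.toAddMonoid t) = f'.comp (AddMonoidHom.inr _ _) := by
    refine DirectSum.addHom_ext' fun i => ?_
    rw [← ht]
    ext
    simp
  refine ⟨(s.coprod (DirectSum.toAddMonoid t)).comp φ.toAddMonoidHom, ?_⟩
  rw [← AddMonoidHom.comp_assoc, AddMonoidHom.comp_coprod, hs, htors]
  ext q
  simp [f']

/-- Multiplicative form of `exists_addMonoidHom_lift_of_pure_ker`. -/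
theorem exists_monoidHom_lift_of_pure_ker {A C Q : Type*} [CommGroup A] [CommGroup C]
    [CommGroup Q] [Group.FG Q] (k : A →* C) (hk : Function.Surjective k)
    (hpure : ∀ (n : ℕ) (a : A), k (a ^ n) = 1 → ∃ p, k p = 1 ∧ p ^ n = a ^ n) (f : Q →* C) :
    ∃ s : Q →* A, k.comp s = f := by
  obtain ⟨s, hs⟩ := exists_addMonoidHom_lift_of_pure_ker k.toAdditive hk hpure f.toAdditive
  exact ⟨AddMonoidHom.toMultiplicative s, MonoidHom.ext fun q => DFunLike.congr_fun hs q⟩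

open scoped commutatorElement in
/-- Every element of the commutator subgroup is a value of a word in the commutator subgroup
of a free group of finite rank. -/
theorem exists_lift_eq_of_mem_commutator {G : Type*} [Group G] {c : G} (hc : c ∈ commutator G) :
    ∃ (n : ℕ) (g : Fin n → G), ∃ w ∈ commutator (FreeGroup (Fin n)), FreeGroup.lift g w = c := by
  rw [commutator_eq_closure] at hc
  induction hc using Subgroup.closure_induction with
  | mem x hx =>
    obtain ⟨a, b, rfl⟩ := hx
    refine ⟨2, ![a, b], ⁅FreeGroup.of (0 : Fin 2), FreeGroup.of 1⁆, ?_, ?_⟩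
    · exact Subgroup.commutator_mem_commutator (Subgroup.mem_top _) (Subgroup.mem_top _)
    · simp [map_commutatorElement]
  | one => exact ⟨0, Fin.elim0, 1, one_mem _, map_one _⟩
  | mul x y _ _ hx hy =>
    obtain ⟨n, g, w, hw, rfl⟩ := hx
    obtain ⟨m, g', w', hw', rfl⟩ := hy
    have hmap {k l : ℕ} (f : Fin k → Fin l) {v : FreeGroup (Fin k)} (hv : v ∈ commutator _) :
        FreeGroup.map f v ∈ commutator (FreeGroup (Fin l)) :=
      Subgroup.commutator_mono le_top le_top
        (Subgroup.map_commutator ⊤ ⊤ (FreeGroup.map f) ▸ Subgroup.mem_map_of_mem _ hv)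
    refine ⟨n + m, Fin.append g g',
      FreeGroup.map (Fin.castAdd m) w * FreeGroup.map (Fin.natAdd n) w',
      mul_mem (hmap _ hw) (hmap _ hw'), ?_⟩
    have hl : (FreeGroup.lift (Fin.append g g')).comp (FreeGroup.map (Fin.castAdd m)) =
        FreeGroup.lift g := by ext; simp
    have hr : (FreeGroup.lift (Fin.append g g')).comp (FreeGroup.map (Fin.natAdd n)) =
        FreeGroup.lift g' := by ext; simp
    rw [map_mul, ← hl, ← hr, MonoidHom.comp_apply, MonoidHom.comp_apply]
  | inv x _ hx =>
    obtain ⟨n, g, w, hw, rfl⟩ := hx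
    exact ⟨n, g, w⁻¹, inv_mem hw, map_inv _ _⟩

/-- Words in the commutator subgroup vanish on tuples from a commutative subgroup. -/
theorem lift_eq_one_of_mem_commutator {G : Type*} [Group G] {H : Subgroup G}
    (hab : ∀ a ∈ H, ∀ b ∈ H, a * b = b * a) {α : Type*} {x : α → G} (hx : ∀ i, x i ∈ H)
    {w : FreeGroup α} (hw : w ∈ commutator (FreeGroup α)) : FreeGroup.lift x w = 1 := by
  let _ : CommGroup H := { mul_comm := fun a b => Subtype.ext (hab a a.2 b b.2) }
  have hcomp : H.subtype.comp (FreeGroup.lift fun i => (⟨x i, hx i⟩ : H)) = FreeGroup.lift x := by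
    ext; simp
  rw [← hcomp, MonoidHom.comp_apply,
    Abelianization.commutator_subset_ker (FreeGroup.lift fun i => (⟨x i, hx i⟩ : H)) hw, map_one]

/-- If a verbally closed commutative subgroup contains a `z`-th power up to a product of
commutators, then that element is a `z`-th power in the subgroup. -/
theorem VerballyClosedIn.exists_zpow_eq {G : Type*} [Group G] {H : Subgroup G}
    (hab : ∀ a ∈ H, ∀ b ∈ H, a * b = b * a) (hH : VerballyClosedIn G H) {g c : G} {z : ℤ}
    (hc : c ∈ commutator G) (h : g ^ z * c ∈ H) : ∃ x ∈ H, x ^ z = g ^ z * c := by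
  obtain ⟨n, g', w, hw, rfl⟩ := exists_lift_eq_of_mem_commutator hc
  have key (y : Fin (n + 1) → G) :
      FreeGroup.lift y (FreeGroup.of 0 ^ z * FreeGroup.map Fin.succ w) =
        y 0 ^ z * FreeGroup.lift (fun i => y i.succ) w := by
    have hy : (FreeGroup.lift y).comp (FreeGroup.map Fin.succ) =
        FreeGroup.lift fun i => y i.succ := by ext; simp
    simp [← hy]
  obtain ⟨x, hx, hxw⟩ := hH (n + 1) (FreeGroup.of 0 ^ z * FreeGroup.map Fin.succ w) _ h
    ⟨Fin.cons g g', by rw [key]; simp⟩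
  rw [key, lift_eq_one_of_mem_commutator hab (fun i => hx i.succ) hw, mul_one] at hxw
  exact ⟨x 0, hx 0, hxw⟩

theorem AlgebraicallyClosedIn.verballyClosedIn {G : Type*} [Group G] {H : Subgroup G}
    (hH : AlgebraicallyClosedIn G H) : VerballyClosedIn G H := by
  rintro n w h hh ⟨g, hg⟩
  obtain ⟨x, hx, hxw⟩ := hH n 1
    (fun _ => Monoid.Coprod.inr w * (Monoid.Coprod.inl (⟨h, hh⟩ : H))⁻¹) ⟨g, by simp [hg]⟩
  exact ⟨x, hx, by simpa [mul_inv_eq_one] using hxw 0⟩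

/-- A subgroup that meets the commutator subgroup trivially and has pure image in the
abelianization is algebraically closed. -/
theorem algebraicallyClosedIn_of_pure {G : Type*} [Group G] {H : Subgroup G}
    (hinf : H ⊓ commutator G = ⊥)
    (hpure : ∀ (n : ℕ) (y : Abelianization G), y ^ n ∈ H.map Abelianization.of →
      ∃ p ∈ H.map Abelianization.of, p ^ n = y ^ n) :
    AlgebraicallyClosedIn G H := by
  rintro n m w ⟨g, hg⟩
  let P := H.map (Abelianization.of : G →* Abelianization G)
  let k := QuotientGroup.mk' P
  let f : FreeGroup (Fin n) →* Abelianization G ⧸ P :=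
    FreeGroup.lift fun j => k (Abelianization.of (g j))
  obtain ⟨s, hs⟩ := exists_monoidHom_lift_of_pure_ker k (QuotientGroup.mk'_surjective P)
    (fun d a ha => by
      simp only [k, QuotientGroup.mk'_apply, QuotientGroup.eq_one_iff] at ha ⊢
      exact hpure d a ha) f.range.subtype
  let π := Abelianization.of.comp (Monoid.Coprod.lift H.subtype (FreeGroup.lift g))
  let ρ := π / (s.comp f.rangeRestrict).comp Monoid.Coprod.snd
  have hρ (j : Fin n) : ρ (Monoid.Coprod.inr (FreeGroup.of j)) ∈ P := by
    rw [← QuotientGroup.eq_one_iff, ← QuotientGroup.mk'_apply]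
    have := DFunLike.congr_fun hs (f.rangeRestrict (FreeGroup.of j))
    simp only [MonoidHom.comp_apply] at this
    simp only [ρ, π, MonoidHom.div_apply, map_div, MonoidHom.comp_apply,
      Monoid.Coprod.snd_apply_inr]
    change _ / k _ = 1
    rw [this, Subgroup.subtype_apply, MonoidHom.coe_rangeRestrict]
    simp [f, k]
  choose x hxH hx using hρ
  have hxρ : Abelianization.of.comp (Monoid.Coprod.lift H.subtype (FreeGroup.lift x)) = ρ := by
    refine Monoid.Coprod.hom_ext ?_ ?_
    · ext h
      simp [ρ, π]
    · ext j
      simpa using hx j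
  refine ⟨x, hxH, fun i => ?_⟩
  have hmem : Monoid.Coprod.lift H.subtype (FreeGroup.lift x) (w i) ∈ H := by
    have hle : (Monoid.Coprod.lift H.subtype (FreeGroup.lift x)).range ≤ H := by
      rw [Monoid.Coprod.range_lift, sup_le_iff, Subgroup.range_subtype]
      refine ⟨le_rfl, ?_⟩
      rw [FreeGroup.range_lift_eq_closure, Subgroup.closure_le]
      rintro _ ⟨j, rfl⟩
      exact hxH j
    exact hle ⟨w i, rfl⟩
  have hof : Abelianization.of (Monoid.Coprod.lift H.subtype (FreeGroup.lift x) (w i)) = 1 := by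
    rw [← MonoidHom.comp_apply, hxρ]
    have hsnd : f (Monoid.Coprod.snd (w i)) =
        k (Abelianization.of (Monoid.Coprod.lift H.subtype (FreeGroup.lift g) (w i))) := by
      suffices h : f.comp Monoid.Coprod.snd = k.comp π from DFunLike.congr_fun h (w i)
      refine Monoid.Coprod.hom_ext ?_ ?_
      · ext h
        simpa [π, k] using ((QuotientGroup.eq_one_iff _).2
          (Subgroup.mem_map_of_mem Abelianization.of h.2)).symm
      · ext j
        simp [π, f]
    have hrange : f.rangeRestrict (Monoid.Coprod.snd (w i)) = 1 :=
      Subtype.ext (by simpa [hg] using hsnd)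
    simp [ρ, π, hg, hrange]
  rw [← MonoidHom.mem_ker, Abelianization.ker_of] at hof
  exact (Subgroup.eq_bot_iff_forall _).1 hinf _ ⟨hmem, hof⟩

/-- An abelian subgroup H of a group G is verbally closed in G if and only if
H ∩ [G,G] = 1 and the image of H in the abelianization G/[G,G] is a pure subgroup;
moreover, under these conditions H is algebraically closed in G. -/
theorem abelian_verballyClosed_iff
    {G : Type*} [Group G] (H : Subgroup G)
    (hab : ∀ a ∈ H, ∀ b ∈ H, a * b = b * a) :
    (VerballyClosedIn G H ↔
      (H ⊓ commutator G = ⊥ ∧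
        ∀ n : ℤ, {x : Abelianization G |
            x ∈ H.map ((Abelianization.of : G →* Abelianization G)) ∧ ∃ y : Abelianization G, y ^ n = x} =
          {x : Abelianization G |
            ∃ p ∈ H.map ((Abelianization.of : G →* Abelianization G)), p ^ n = x})) ∧
    ((H ⊓ commutator G = ⊥ ∧
        ∀ n : ℤ, {x : Abelianization G |
            x ∈ H.map ((Abelianization.of : G →* Abelianization G)) ∧ ∃ y : Abelianization G, y ^ n = x} =
          {x : Abelianization G |
            ∃ p ∈ H.map ((Abelianization.of : G →* Abelianization G)), p ^ n = x}) →
      AlgebraicallyClosedIn G H) := by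
  have hAlg : (H ⊓ commutator G = ⊥ ∧
        ∀ n : ℤ, {x : Abelianization G |
            x ∈ H.map ((Abelianization.of : G →* Abelianization G)) ∧ ∃ y : Abelianization G, y ^ n = x} =
          {x : Abelianization G |
            ∃ p ∈ H.map ((Abelianization.of : G →* Abelianization G)), p ^ n = x}) →
      AlgebraicallyClosedIn G H := by
    rintro ⟨hinf, hpure⟩
    refine algebraicallyClosedIn_of_pure hinf fun n y hy => ?_
    obtain ⟨p, hp, hpy⟩ := (hpure n).subset ⟨hy, y, zpow_natCast y n⟩
    exact ⟨p, hp, by rwa [zpow_natCast] at hpy⟩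
  refine ⟨⟨fun hH => ⟨?_, fun n => Set.Subset.antisymm ?_ ?_⟩,
    fun h => (hAlg h).verballyClosedIn⟩, hAlg⟩
  · refine (Subgroup.eq_bot_iff_forall _).2 fun c ⟨hcH, hc⟩ => ?_
    obtain ⟨x, -, hx⟩ := hH.exists_zpow_eq hab (g := 1) (z := 0) hc (by simpa using hcH)
    simpa using hx.symm
  · rintro _ ⟨⟨h, hh, rfl⟩, y, hy⟩
    obtain ⟨g, rfl⟩ := QuotientGroup.mk_surjective y
    have hc : (g ^ n)⁻¹ * h ∈ commutator G := by
      rw [← Abelianization.ker_of, MonoidHom.mem_ker, map_mul, map_inv, map_zpow, ← hy]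
      exact inv_mul_cancel _
    obtain ⟨x, hx, hxh⟩ := hH.exists_zpow_eq hab (g := g) (z := n) hc (by simpa using hh)
    exact ⟨_, Subgroup.mem_map_of_mem _ hx, by rw [← map_zpow, hxh, mul_inv_cancel_left]⟩
  · rintro _ ⟨p, hp, rfl⟩
    exact ⟨zpow_mem hp n, p, rfl⟩
end

section
/- Let G be a finitely generated group and H a subgroup of G isomorphic to the infinite dihedral group. Then the following are equivalent: (1) H is verbally closed in G; (2) H is algebraically closed in G; (3) H is a retract of G. -/
/-- An element of a finitely generated abelian group either takes the value `1` under some integral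
functional, or becomes properly divisible after passing to a suitable multiple. -/
theorem exists_dual_eq_one_or_smul_eq {A : Type*} [AddCommGroup A] [Module.Finite ℤ A] (v : A) :
    (∃ f : A →ₗ[ℤ] ℤ, f v = 1) ∨
      ∃ (N : ℕ) (p : ℤ) (y : A), 0 < N ∧ ¬ IsUnit p ∧ (N : ℤ) • v = ((N : ℤ) * p) • y := by
  set I : Ideal ℤ := LinearMap.range (Module.Dual.eval ℤ A v) with hI
  obtain ⟨p, hp⟩ := (IsPrincipalIdealRing.principal I).principal
  by_cases hu : IsUnit p
  · left
    have h1 : (1 : ℤ) ∈ I := by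
      rw [hp]
      exact Ideal.mem_span_singleton.2 hu.dvd
    obtain ⟨f, hf⟩ := h1
    exact ⟨f, hf⟩
  · right
    have hdvd (f : A →ₗ[ℤ] ℤ) : p ∣ f v := by
      have hm : f v ∈ I := ⟨f, rfl⟩
      rw [hp] at hm
      exact Ideal.mem_span_singleton.1 hm
    let T := Submodule.torsion ℤ A
    let b := Module.Free.chooseBasis ℤ (A ⧸ T)
    choose c hc using fun i => hdvd ((b.coord i).comp T.mkQ)
    obtain ⟨y, hy⟩ := T.mkQ_surjective (∑ i, c i • b i)
    have hv : T.mkQ v = p • T.mkQ y := by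
      rw [hy, ← b.sum_repr (T.mkQ v), Finset.smul_sum]
      refine Finset.sum_congr rfl fun i _ => ?_
      rw [smul_smul, ← hc i]
      rfl
    have hmem : v - p • y ∈ T := by
      rw [← Submodule.ker_mkQ T, LinearMap.mem_ker, map_sub, map_smul, hv, sub_self]
    obtain ⟨a, ha⟩ := (Submodule.mem_torsion_iff _).1 hmem
    have ha0 : (a : ℤ) ≠ 0 := nonZeroDivisors.coe_ne_zero a
    have ha' : (a : ℤ) • (v - p • y) = 0 := ha
    refine ⟨(a : ℤ).natAbs, p, y, Int.natAbs_pos.2 ha0, hu, ?_⟩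
    have key : (((a : ℤ).natAbs : ℤ)) • (v - p • y) = 0 := by
      rcases Int.natAbs_eq (a : ℤ) with h | h
      · rwa [← h]
      · rw [← neg_eq_iff_eq_neg.2 h, neg_smul, ha', neg_zero]
    rwa [smul_sub, sub_eq_zero, smul_smul] at key

/-- A crossed homomorphism from `G` to an abelian group on which `G` acts by signs. -/
def IsSignCrossed {G A : Type*} [Group G] [AddCommGroup A] (e : G →* ℤˣ) (d : G → A) : Prop :=
  ∀ x y, d (x * y) = d x + e x • d y

namespace IsSignCrossed

variable {G A B : Type*} [Group G] [AddCommGroup A] [AddCommGroup B] {e : G →* ℤˣ} {d : G → A}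

theorem map_one (h : IsSignCrossed e d) : d 1 = 0 := by
  simpa using h 1 1

theorem map_inv (h : IsSignCrossed e d) (x : G) : d x⁻¹ = -(e x • d x) := by
  have h1 := h x⁻¹ x
  rw [inv_mul_cancel, h.map_one] at h1
  rw [eq_neg_of_add_eq_zero_left h1.symm, MonoidHom.map_inv, Int.units_inv_eq_self]

theorem map_conj (h : IsSignCrossed e d) (x : G) {y : G} (hy : e y = 1) :
    d (x * y * x⁻¹) = e x • d y := by
  rw [h, h, h.map_inv, map_mul, hy, mul_one, smul_neg, smul_smul, Int.units_mul_self, one_smul]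
  abel

theorem map_pow (h : IsSignCrossed e d) {x : G} (hx : e x = 1) (n : ℕ) :
    d (x ^ n) = n • d x := by
  induction n with
  | zero => simpa using h.map_one
  | succ n ih => rw [pow_succ, h, ih, MonoidHom.map_pow, hx, one_pow, one_smul, succ_nsmul]

theorem comp_linear (h : IsSignCrossed e d) (f : A →ₗ[ℤ] B) :
    IsSignCrossed e (fun x => f (d x)) := by
  intro x y
  simp only [h x y, map_add, Units.smul_def, map_smul]

/-- Subtracting a constant at the elements of negative sign preserves crossed homomorphisms. -/
theorem sub_ite (h : IsSignCrossed e d) (s : A) :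
    IsSignCrossed e (fun x => d x - if e x = 1 then 0 else s) := by
  intro x y
  simp only [h x y, map_mul]
  rcases Int.units_eq_one_or (e x) with hx | hx <;>
    rcases Int.units_eq_one_or (e y) with hy | hy <;>
    simp [hx, hy, Units.smul_def] <;> abel

theorem freeGroup_ext {ι : Type*} {e : FreeGroup ι →* ℤˣ} {d d' : FreeGroup ι → A}
    (h : IsSignCrossed e d) (h' : IsSignCrossed e d')
    (hof : ∀ i, d (FreeGroup.of i) = d' (FreeGroup.of i)) (x : FreeGroup ι) : d x = d' x := by
  induction x using FreeGroup.induction_on with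
  | C1 => rw [h.map_one, h'.map_one]
  | of i => exact hof i
  | inv_of i hi => rw [h.map_inv, h'.map_inv, hi]
  | mul x y hx hy => rw [h, h', hx, hy]

theorem exists_freeGroup {ι : Type*} (e : FreeGroup ι →* ℤˣ) (v : ι → A) :
    ∃ d : FreeGroup ι → A, IsSignCrossed e d ∧ ∀ i, d (FreeGroup.of i) = v i := by
  let act : ℤˣ →* MulAut (Multiplicative A) :=
    { toFun u := AddEquiv.toMultiplicative (DistribMulAction.toAddEquiv A u)
      map_one' := by ext x; exact one_smul ℤˣ (Multiplicative.toAdd x)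
      map_mul' u w := by ext x; exact mul_smul u w (Multiplicative.toAdd x) }
  let F : FreeGroup ι →* Multiplicative A ⋊[act] ℤˣ :=
    FreeGroup.lift fun i => ⟨Multiplicative.ofAdd (v i), e (FreeGroup.of i)⟩
  have hF : SemidirectProduct.rightHom.comp F = e := by
    ext i
    simp [F]
  refine ⟨fun x => Multiplicative.toAdd (F x).left, fun x y => ?_, fun i => ?_⟩
  · have hr : (F x).right = e x := DFunLike.congr_fun hF x
    change Multiplicative.toAdd (F (x * y)).left = _
    rw [map_mul, SemidirectProduct.mul_left, hr]
    rfl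
  · simp [F]

end IsSignCrossed

namespace DihedralGroup

/-- The sign of an element of the infinite dihedral group: `1` for translations and `-1` for
reflections. -/
def sign : DihedralGroup 0 →* ℤˣ where
  toFun
    | r _ => 1
    | sr _ => -1
  map_one' := rfl
  map_mul' := by rintro (i | i) (j | j) <;> rfl

/-- The translation part of an element of the infinite dihedral group. -/
def translation : DihedralGroup 0 → ℤ
  | r i => i
  | sr i => -(show ℤ from i)

theorem isSignCrossed_translation : IsSignCrossed sign translation := by
  have neg_smul' (x : ℤ) : (-1 : ℤˣ) • x = -x := by simp [Units.smul_def]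
  rintro (i | i) (j | j)
  · exact congrArg (fun z : ℤ => (show ℤ from i) + z) (one_smul ℤˣ (show ℤ from j)).symm
  · change -((show ℤ from j) - (show ℤ from i)) = (show ℤ from i) + (1 : ℤˣ) • -(show ℤ from j)
    rw [one_smul]; ring
  · change -((show ℤ from i) + (show ℤ from j)) = -(show ℤ from i) + (-1 : ℤˣ) • (show ℤ from j)
    rw [neg_smul']; ring
  · change (show ℤ from j) - (show ℤ from i) = -(show ℤ from i) + (-1 : ℤˣ) • -(show ℤ from j)
    rw [neg_smul']; ring

theorem ext_sign_translation {x y : DihedralGroup 0} (hs : sign x = sign y)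
    (ht : translation x = translation y) : x = y := by
  rcases x with i | i <;> rcases y with j | j
  · exact congrArg r ht
  · exact absurd hs (by decide : (1 : ℤˣ) ≠ -1)
  · exact absurd hs (by decide : (-1 : ℤˣ) ≠ 1)
  · exact congrArg sr (neg_injective ht : (show ℤ from i) = j)

theorem exists_sign_translation_eq (u : ℤˣ) (t : ℤ) :
    ∃ x : DihedralGroup 0, sign x = u ∧ translation x = t := by
  rcases Int.units_eq_one_or u with rfl | rfl
  · exact ⟨r t, rfl, rfl⟩
  · exact ⟨sr (-t : ℤ), rfl, neg_neg t⟩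

/-- Signs and crossed homomorphisms to `ℤ` assemble to homomorphisms to the infinite dihedral
group. -/
theorem exists_hom_of_isSignCrossed {G : Type*} [Group G] {e : G →* ℤˣ} {d : G → ℤ}
    (h : IsSignCrossed e d) :
    ∃ φ : G →* DihedralGroup 0, ∀ x, sign (φ x) = e x ∧ translation (φ x) = d x := by
  choose φ hφ using fun x => exists_sign_translation_eq (e x) (d x)
  refine ⟨MonoidHom.mk' φ fun x y => ext_sign_translation ?_ ?_, hφ⟩
  · rw [map_mul, (hφ _).1, (hφ _).1, (hφ _).1, map_mul]
  · rw [isSignCrossed_translation, (hφ _).2, (hφ _).2, (hφ _).2, (hφ _).1, h]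

end DihedralGroup

theorem prod_one_add_units_mul {ι : Type*} [Fintype ι] [DecidableEq ι] (ε δ : ι → ℤˣ) :
    ∏ i, (1 + (ε i : ℤ) * (δ i : ℤ)) = if ε = δ then 2 ^ Fintype.card ι else 0 := by
  split_ifs with h
  · subst h
    have h2 (i : ι) : 1 + (ε i : ℤ) * (ε i : ℤ) = 2 := by
      rw [← Units.val_mul, Int.units_mul_self]; rfl
    rw [Finset.prod_congr rfl fun i _ => h2 i, Finset.prod_const, Finset.card_univ]
  · obtain ⟨i, hi⟩ := Function.ne_iff.1 h
    refine Finset.prod_eq_zero (Finset.mem_univ i) ?_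
    rcases Int.units_eq_one_or (ε i) with h1 | h1 <;>
      rcases Int.units_eq_one_or (δ i) with h2 | h2 <;> simp_all

/-- Averaging over all sign vectors: elements of a subgroup stable under the coordinate signs can be
glued along the diagonal, up to a power of two. -/
theorem AddSubgroup.smul_diagonal_mem_of_sign_stable {ι A : Type*} [Fintype ι] [AddCommGroup A]
    (Q : AddSubgroup ((ι → ℤˣ) → A)) (hQ : ∀ i, ∀ f ∈ Q, (fun δ => δ i • f δ) ∈ Q)
    (f : (ι → ℤˣ) → (ι → ℤˣ) → A) (hf : ∀ ε, f ε ∈ Q) :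
    (fun δ => (2 ^ Fintype.card ι : ℤ) • f δ δ) ∈ Q := by
  classical
  have hprod (ε : ι → ℤˣ) (s : Finset ι) :
      (fun δ => (∏ i ∈ s, (1 + (ε i : ℤ) * (δ i : ℤ))) • f ε δ) ∈ Q := by
    induction s using Finset.induction_on with
    | empty => simpa using hf ε
    | insert i s hi ih =>
      convert Q.add_mem ih (Q.zsmul_mem (hQ i _ ih) (ε i : ℤ)) using 1
      funext δ
      simp only [Finset.prod_insert hi, Pi.add_apply, Pi.smul_apply, Units.smul_def, smul_smul,
        ← add_smul]
      congr 1
      ring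
  convert Q.sum_mem fun ε (_ : ε ∈ Finset.univ) => hprod ε Finset.univ using 1
  funext δ
  simp [prod_one_add_units_mul, ite_smul]

/-- Let `R` be a normal subgroup of a free group `F` and suppose that every `α ^ M * r` with `r ∈ R`
is sent to the `M`-th power of the generating translation by some homomorphism to the infinite
dihedral group. If `β` inverts `α ^ 2` modulo `R`, then a single homomorphism kills `R`, sends `α` to the
generating translation, and sends `β` to the generating reflection. -/
theorem DihedralGroup.exists_hom_freeGroup {ι : Type*} [Fintype ι] (R : Subgroup (FreeGroup ι))
    [R.Normal] (α β : FreeGroup ι) (hβ : β * α ^ 2 * β⁻¹ * α ^ 2 ∈ R)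
    (hsol : ∀ (M : ℕ), ∀ r ∈ R, ∃ φ : FreeGroup ι →* DihedralGroup 0,
      φ (α ^ M * r) = DihedralGroup.r (M : ZMod 0)) :
    ∃ φ : FreeGroup ι →* DihedralGroup 0, R ≤ φ.ker ∧ φ α = DihedralGroup.r 1 ∧
      φ β = DihedralGroup.sr 0 := by
  classical
  let e (δ : ι → ℤˣ) : FreeGroup ι →* ℤˣ := FreeGroup.lift δ
  choose d hd hd_of using fun δ : ι → ℤˣ =>
    IsSignCrossed.exists_freeGroup (e δ) fun i : ι => (Pi.single i 1 : ι → ℤ)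
  have esq (δ : ι → ℤˣ) (w : FreeGroup ι) : e δ (w ^ 2) = 1 := by
    rw [map_pow, Int.units_sq]
  let Q : AddSubgroup ((ι → ℤˣ) → ι → ℤ) :=
    { carrier := {f | ∃ w ∈ R, ∀ δ, e δ w = 1 ∧ d δ w = f δ}
      zero_mem' := ⟨1, R.one_mem, fun δ => ⟨map_one _, (hd δ).map_one⟩⟩
      add_mem' := by
        rintro f f' ⟨w, hw, h⟩ ⟨w', hw', h'⟩
        refine ⟨w * w', R.mul_mem hw hw', fun δ => ⟨?_, ?_⟩⟩
        · rw [map_mul, (h δ).1, (h' δ).1, one_mul]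
        · rw [hd, (h δ).1, (h δ).2, (h' δ).2, one_smul]; rfl
      neg_mem' := by
        rintro f ⟨w, hw, h⟩
        refine ⟨w⁻¹, R.inv_mem hw, fun δ => ⟨?_, ?_⟩⟩
        · rw [map_inv, (h δ).1, inv_one]
        · rw [(hd δ).map_inv, (h δ).1, (h δ).2, one_smul]; rfl }
  have hQ (i : ι) : ∀ f ∈ Q, (fun δ => δ i • f δ) ∈ Q := by
    rintro f ⟨w, hw, h⟩
    refine ⟨FreeGroup.of i * w * (FreeGroup.of i)⁻¹, Subgroup.Normal.conj_mem ‹_› w hw _,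
      fun δ => ⟨?_, ?_⟩⟩
    · rw [map_mul, map_mul, (h δ).1, mul_one, ← map_mul, mul_inv_cancel, map_one]
    · rw [(hd δ).map_conj _ (h δ).1, (h δ).2]
      simp [e]
  by_contra hno
  have hlocal (δ : ι → ℤˣ) : ∃ (M : ℕ) (p : ℤ) (y : ι → ℤ), 0 < M ∧ ¬ IsUnit p ∧ ∃ f ∈ Q,
      (M : ℤ) • d δ (α ^ 2) + f δ = (2 * M * p) • y := by
    by_cases hα : e δ α = 1
    swap
    · refine ⟨1, 0, 0, one_pos, not_isUnit_zero, 0, Q.zero_mem, ?_⟩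
      have hα' : e δ α = -1 := (Int.units_eq_one_or _).resolve_left hα
      rw [pow_two, hd, hα']
      simp [Units.smul_def]
    by_cases hβ1 : e δ β = 1
    · refine ⟨2, 0, 0, two_pos, not_isUnit_zero,
        -fun δ' => d δ' (β * α ^ 2 * β⁻¹ * α ^ 2), Q.neg_mem ⟨_, hβ, fun δ' => ⟨?_, rfl⟩⟩, ?_⟩
      · rw [map_mul, map_mul, map_mul, esq, mul_one, mul_one, ← map_mul, mul_inv_cancel, map_one]
      · have hconj : e δ (β * α ^ 2 * β⁻¹) = 1 := by
          rw [map_mul, map_mul, esq, mul_one, ← map_mul, mul_inv_cancel, map_one]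
        rw [Pi.neg_apply, hd, (hd δ).map_conj _ (esq δ α), hconj, hβ1, one_smul]
        simp [two_smul]
    by_cases hR : ∃ w ∈ R, e δ w ≠ 1
    · obtain ⟨w, hw, hw1⟩ := hR
      have hw' : e δ w = -1 := (Int.units_eq_one_or _).resolve_left hw1
      have hconj (δ' : ι → ℤˣ) : e δ' (w * α ^ 2 * w⁻¹) = 1 := by
        rw [map_mul, map_mul, esq, mul_one, ← map_mul, mul_inv_cancel, map_one]
      refine ⟨2, 0, 0, two_pos, not_isUnit_zero,
        fun δ' => d δ' (w * α ^ 2 * w⁻¹ * (α ^ 2)⁻¹), ⟨_, ?_, fun δ' => ⟨?_, rfl⟩⟩, ?_⟩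
      · rw [mul_assoc, mul_assoc, ← mul_assoc (α ^ 2)]
        exact R.mul_mem hw (Subgroup.Normal.conj_mem ‹_› _ (R.inv_mem hw) _)
      · rw [map_mul, hconj, map_inv, esq, inv_one, one_mul]
      · beta_reduce
        rw [hd, hconj, (hd δ).map_conj _ (esq δ α), (hd δ).map_inv, esq, hw']
        simp [two_smul, Units.smul_def]
    push Not at hR
    let L : Submodule ℤ (ι → ℤ) := AddSubgroup.toIntSubmodule
      { carrier := {z | ∃ w ∈ R, d δ w = z}
        zero_mem' := ⟨1, R.one_mem, (hd δ).map_one⟩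
        add_mem' := by
          rintro _ _ ⟨w, hw, rfl⟩ ⟨w', hw', rfl⟩
          exact ⟨w * w', R.mul_mem hw hw', by rw [hd, hR w hw, one_smul]⟩
        neg_mem' := by
          rintro _ ⟨w, hw, rfl⟩
          exact ⟨w⁻¹, R.inv_mem hw, by rw [(hd δ).map_inv, hR w hw, one_smul]⟩ }
    rcases exists_dual_eq_one_or_smul_eq (L.mkQ (d δ α)) with ⟨t, ht⟩ | ⟨N, p, y, hN, hp, hy⟩
    · refine absurd ?_ hno
      have hβ' : e δ β = -1 := (Int.units_eq_one_or _).resolve_left hβ1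
      have hk := ((hd δ).comp_linear (t.comp L.mkQ)).sub_ite (t (L.mkQ (d δ β)))
      obtain ⟨φ, hφ⟩ := DihedralGroup.exists_hom_of_isSignCrossed hk
      refine ⟨φ, fun w hw => ?_, ?_, ?_⟩
      · have hL : L.mkQ (d δ w) = 0 := (Submodule.Quotient.mk_eq_zero L).2 ⟨w, hw, rfl⟩
        refine DihedralGroup.ext_sign_translation ((hφ w).1.trans (hR w hw)) ((hφ w).2.trans ?_)
        rw [if_pos (hR w hw), sub_zero, LinearMap.comp_apply, hL, map_zero]
        rfl
      · refine DihedralGroup.ext_sign_translation ((hφ α).1.trans hα) ((hφ α).2.trans ?_)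
        rw [if_pos hα, sub_zero, LinearMap.comp_apply, ht]
        rfl
      · refine DihedralGroup.ext_sign_translation ((hφ β).1.trans hβ') ((hφ β).2.trans ?_)
        rw [if_neg hβ1, LinearMap.comp_apply, sub_self]
        rfl
    · obtain ⟨y, rfl⟩ := L.mkQ_surjective y
      have hmem : ((N : ℤ) * p) • y - (N : ℤ) • d δ α ∈ L := by
        rw [← Submodule.ker_mkQ L, LinearMap.mem_ker, map_sub, map_smul, map_smul, hy, sub_self]
      obtain ⟨w, hw, hdw⟩ := hmem
      refine ⟨N, p, y, hN, hp, fun δ' => d δ' (w ^ 2), ⟨_, R.pow_mem hw 2, fun δ' => ⟨esq _ _, rfl⟩⟩,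
        ?_⟩
      simp only [(hd δ).map_pow (hR w hw), (hd δ).map_pow hα, hdw]
      module
  choose M p y hM hp f hf hy using hlocal
  let P : ℕ := ∏ δ, M δ
  have hP : 0 < P := Finset.prod_pos fun δ _ => hM δ
  choose c hc using fun δ => Finset.dvd_prod_of_mem M (Finset.mem_univ δ)
  obtain ⟨w, hw, hdw⟩ := Q.smul_diagonal_mem_of_sign_stable hQ
    (fun ε => (c ε : ℤ) • f ε) fun ε => Q.zsmul_mem (hf ε) _
  obtain ⟨φ, hφ⟩ := hsol (2 * (2 ^ Fintype.card ι * P)) w hw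
  let δ : ι → ℤˣ := fun i => DihedralGroup.sign (φ (FreeGroup.of i))
  let T : (ι → ℤ) →ₗ[ℤ] ℤ := Fintype.linearCombination ℤ fun i =>
    DihedralGroup.translation (φ (FreeGroup.of i))
  have hsign : DihedralGroup.sign.comp φ = e δ := by
    ext i
    simp [e, δ]
  have htrans (v : FreeGroup ι) : DihedralGroup.translation (φ v) = T (d δ v) := by
    refine IsSignCrossed.freeGroup_ext (e := e δ)
      (d := fun v => DihedralGroup.translation (φ v)) (fun a b => ?_) ((hd δ).comp_linear T)
      (fun i => ?_) v
    · beta_reduce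
      rw [map_mul, DihedralGroup.isSignCrossed_translation, ← hsign]
      rfl
    · rw [hd_of]
      simp [T]
  have hval : ((2 * (2 ^ Fintype.card ι * P) : ℕ) : ℤ) =
      T (d δ (α ^ (2 * (2 ^ Fintype.card ι * P)) * w)) := by
    rw [← htrans, hφ]
    rfl
  have hd2 : d δ (α ^ (2 * (2 ^ Fintype.card ι * P)) * w) =
      (((2 * (2 ^ Fintype.card ι * P) : ℕ) : ℤ) * p δ) • y δ := by
    have hPc : (P : ℤ) = M δ * c δ := by exact_mod_cast hc δ
    rw [hd, pow_mul, map_pow, esq, one_pow, one_smul, (hd δ).map_pow (esq δ α), (hdw δ).2]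
    have := congrArg (fun z => ((2 : ℤ) ^ Fintype.card ι * c δ) • z) (hy δ)
    simp only [smul_add, smul_smul] at this
    push_cast
    rw [← natCast_zsmul, hPc]
    push_cast
    rw [hPc]
    simp only [Pi.smul_apply, smul_smul]
    convert this using 2
    · congr 1; ring
    · ring
  rw [hd2, map_smul, smul_eq_mul, mul_assoc] at hval
  have h0 : ((2 * (2 ^ Fintype.card ι * P) : ℕ) : ℤ) ≠ 0 := by positivity
  exact hp δ (IsUnit.of_mul_eq_one _ (mul_left_cancel₀ h0 (hval.symm.trans (mul_one _).symm)))

theorem AlgebraicallyClosedIn.of_retraction {G : Type*} [Group G] {H : Subgroup G} (ρ : G →* H)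
    (hρ : ∀ h : H, ρ (h : G) = h) : AlgebraicallyClosedIn G H := by
  rintro n m w ⟨g, hg⟩
  refine ⟨fun i => ρ (g i), fun i => (ρ (g i)).2, fun i => ?_⟩
  have hcomp : Monoid.Coprod.lift H.subtype (FreeGroup.lift fun i => (ρ (g i) : G)) =
      (H.subtype.comp ρ).comp (Monoid.Coprod.lift H.subtype (FreeGroup.lift g)) := by
    ext x <;> simp [hρ]
  rw [hcomp, MonoidHom.comp_apply, hg, map_one]

theorem VerballyClosedIn.exists_hom {G : Type*} [Group G] {H : Subgroup G}
    (hH : VerballyClosedIn G H) {n : ℕ} (π : FreeGroup (Fin n) →* G) (w : FreeGroup (Fin n))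
    (h : H) (hw : π w = h) : ∃ φ : FreeGroup (Fin n) →* H, φ w = h := by
  obtain ⟨x, hxH, hx⟩ := hH n w h h.2 ⟨fun i => π (FreeGroup.of i), by
    rw [← hw]
    congr 1
    ext i
    simp⟩
  refine ⟨FreeGroup.lift fun i => ⟨x i, hxH i⟩, Subtype.ext ?_⟩
  rw [← hx, ← H.subtype_apply, ← MonoidHom.comp_apply]
  congr 1
  ext i
  simp

theorem DihedralGroup.hom_ext {n : ℕ} {M : Type*} [Group M] {f g : DihedralGroup n →* M}
    (hr : f (r 1) = g (r 1)) (hsr : f (sr 0) = g (sr 0)) : f = g := by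
  have h (i : ZMod n) : f (r i) = g (r i) := by
    obtain ⟨k, rfl⟩ := ZMod.intCast_surjective i
    rw [← r_one_zpow, map_zpow, map_zpow, hr]
  ext (i | i)
  · exact h i
  · rw [← zero_add i, ← sr_mul_r, map_mul, map_mul, hsr, h]

theorem VerballyClosedIn.exists_retraction {G : Type*} [Group G] [Group.FG G] {H : Subgroup G}
    (hH : VerballyClosedIn G H) (θ : H ≃* DihedralGroup 0) :
    ∃ ρ : G →* H, ∀ h : H, ρ (h : G) = h := by
  obtain ⟨ι, _, π', hπ'⟩ := Group.fg_iff_exists_freeGroup_hom_surjective_finite.1 ‹Group.FG G›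
  obtain ⟨n, ⟨σ⟩⟩ := Finite.exists_equiv_fin ι
  let π : FreeGroup (Fin n) →* G := π'.comp (FreeGroup.freeGroupCongr σ.symm).toMonoidHom
  have hπ : Function.Surjective π := hπ'.comp (FreeGroup.freeGroupCongr σ.symm).surjective
  let j : DihedralGroup 0 →* G := H.subtype.comp θ.symm.toMonoidHom
  obtain ⟨α, hα⟩ := hπ (j (DihedralGroup.r 1))
  obtain ⟨β, hβ⟩ := hπ (j (DihedralGroup.sr 0))
  have hrel : β * α ^ 2 * β⁻¹ * α ^ 2 ∈ π.ker := by
    rw [MonoidHom.mem_ker]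
    simp only [map_mul, map_inv, map_pow, hα, hβ]
    simp only [← map_mul, ← map_inv, ← map_pow]
    exact map_one j
  obtain ⟨φ, hφR, hφα, hφβ⟩ := DihedralGroup.exists_hom_freeGroup π.ker α β hrel fun M r hr => by
    obtain ⟨φ, hφ⟩ := hH.exists_hom π (α ^ M * r) (θ.symm (DihedralGroup.r (M : ZMod 0))) (by
      rw [map_mul, MonoidHom.mem_ker.1 hr, mul_one, map_pow, hα, ← map_pow,
        DihedralGroup.r_one_pow]
      rfl)
    exact ⟨θ.toMonoidHom.comp φ, by simp [hφ]⟩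
  let ψ : G →* DihedralGroup 0 := π.liftOfSurjective hπ ⟨φ, hφR⟩
  have hψ (w : FreeGroup (Fin n)) : ψ (π w) = φ w := π.liftOfRightInverse_comp_apply _ _ ⟨φ, hφR⟩ w
  have hid : ψ.comp j = MonoidHom.id _ :=
    DihedralGroup.hom_ext (by simp [← hα, hψ, hφα]) (by simp [← hβ, hψ, hφβ])
  refine ⟨θ.symm.toMonoidHom.comp ψ, fun h => ?_⟩
  have hh := DFunLike.congr_fun hid (θ h)
  simp only [j, MonoidHom.comp_apply, MulEquiv.toMonoidHom_eq_coe, MonoidHom.coe_coe,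
    MulEquiv.symm_apply_apply, H.subtype_apply, MonoidHom.id_apply] at hh
  simp [hh]

/-- For a subgroup H of a finitely generated group G with H isomorphic to the infinite
dihedral group, the following are equivalent: H is verbally closed in G; H is
algebraically closed in G; H is a retract of G. -/
theorem infiniteDihedralSubgroup_tfae
    {G : Type*} [Group G] [Group.FG G] (H : Subgroup G)
    (hiso : Nonempty (H ≃* DihedralGroup 0)) :
    (VerballyClosedIn G H ↔ AlgebraicallyClosedIn G H) ∧
    (VerballyClosedIn G H ↔ ∃ ρ : G →* H, ∀ h : H, ρ (h : G) = h) := by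
  obtain ⟨θ⟩ := hiso
  have of_retraction : (∃ ρ : G →* H, ∀ h : H, ρ (h : G) = h) → AlgebraicallyClosedIn G H :=
    fun ⟨ρ, hρ⟩ => .of_retraction ρ hρ
  exact ⟨⟨fun h => of_retraction (h.exists_retraction θ), fun h => h.verballyClosedIn⟩,
    ⟨fun h => h.exists_retraction θ, fun h => (of_retraction h).verballyClosedIn⟩⟩
end

section
/- Let G be a finitely generated group, H = ⟨b⟩₂ ⋉ ⟨a⟩∞ an infinite dihedral subgroup of G (with b of order 2 and a of infinite order), and Q = ⟨{g² : g ∈ G}⟩ the subgroup of G generated by all squares. Then H is verbally closed in G if and only if the coset a²[Q,Q] is a simple element of the finitely generated abelian group A = Q/[Q,Q] regarded as a module over the finite elementary abelian 2-group C = G/Q acting by conjugation. -/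
open scoped TensorProduct

/-- The subgroup Q = ⟨{g² : g ∈ G}⟩ of G generated by the squares of all elements
(the generating set is closed under conjugation, so this is the normal closure). -/
def squareSubgroup (G : Type*) [Group G] : Subgroup G :=
  Subgroup.normalClosure {x : G | ∃ g : G, g ^ 2 = x}

/-- Q is a normal subgroup of G. -/
instance squareSubgroup_normal (G : Type*) [Group G] : (squareSubgroup G).Normal :=
  Subgroup.normalClosure_normal

variable {G : Type*} [Group G]

/-- The endomorphism of ℚ ⊗ (Q/[Q,Q]) induced by the action of an element
c of C = G/Q on A = Q/[Q,Q]. -/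
noncomputable def tensorAction
    (σ : (G ⧸ squareSubgroup G) →* MulAut (Abelianization ↥(squareSubgroup G)))
    (c : G ⧸ squareSubgroup G) :
    ℚ ⊗[ℤ] Additive (Abelianization ↥(squareSubgroup G)) →ₗ[ℤ]
      ℚ ⊗[ℤ] Additive (Abelianization ↥(squareSubgroup G)) :=
  LinearMap.lTensor ℚ
    ((MonoidHom.toAdditive (σ c).toMonoidHom).toIntLinearMap)

/-- The projection p_χ = 2^{-|C|} · ∏_{c ∈ C} (1 + χ(c)·c) onto the χ-eigenspace of
the rational vector space ℚ ⊗ (Q/[Q,Q]), for a character χ : C → {±1} of C = G/Q; the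
product of the (commuting) factors is computed as an iterated application over an
enumeration of C. -/
noncomputable def eigenProjection [Fintype (G ⧸ squareSubgroup G)]
    (σ : (G ⧸ squareSubgroup G) →* MulAut (Abelianization ↥(squareSubgroup G)))
    (χ : (G ⧸ squareSubgroup G) →* ℤˣ)
    (v : ℚ ⊗[ℤ] Additive (Abelianization ↥(squareSubgroup G))) :
    ℚ ⊗[ℤ] Additive (Abelianization ↥(squareSubgroup G)) :=
  ((2 : ℚ) ^ Nat.card (G ⧸ squareSubgroup G))⁻¹ •
    (Finset.univ : Finset (G ⧸ squareSubgroup G)).toList.foldr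
      (fun c w => w + ((χ c : ℤ) : ℚ) • tensorAction σ c w) v

/-- An element q of A = Q/[Q,Q] is a simple element of the C-module A (where
C = G/Q acts via σ) if for some character χ : C → {±1} the vector p_χ(1 ⊗ q) is a
primitive element of the free abelian group p_χ(1 ⊗ A), i.e. p_χ(1 ⊗ q) ∉ k·p_χ(1 ⊗ A)
for every integer k ≠ ±1. -/
def IsSimpleElement [Fintype (G ⧸ squareSubgroup G)]
    (σ : (G ⧸ squareSubgroup G) →* MulAut (Abelianization ↥(squareSubgroup G)))
    (q : Abelianization ↥(squareSubgroup G)) : Prop :=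
  ∃ χ : (G ⧸ squareSubgroup G) →* ℤˣ, ∀ k : ℤ,
    (∃ x : Abelianization ↥(squareSubgroup G),
        eigenProjection σ χ ((1 : ℚ) ⊗ₜ[ℤ] Additive.ofMul q) =
          k • eigenProjection σ χ ((1 : ℚ) ⊗ₜ[ℤ] Additive.ofMul x)) →
    k = 1 ∨ k = -1

section SignedProducts

theorem list_prod_mul_eq_smul {R : Type*} [Ring R] {l : List R} {z e : R} {s : ℤ} (he : e ∈ l)
    (hl : ∀ x ∈ l, Commute x z) (hez : e * z = s • e) : l.prod * z = s • l.prod := by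
  induction l with
  | nil => simp at he
  | cons x l ih =>
    rw [List.prod_cons]
    have hcomm : Commute l.prod z := Commute.list_prod_left _ _ fun y hy => hl y (by simp [hy])
    rcases List.mem_cons.1 he with rfl | he
    · rw [mul_assoc, hcomm.eq, ← mul_assoc, hez, smul_mul_assoc]
    · rw [mul_assoc, ih he fun y hy => hl y (by simp [hy]), mul_smul_comm]

/-- The product `∏ i, (1 + χ i • y i)`, with the factors taken in increasing order of `i`. -/
def signedProd {R : Type*} [Ring R] {n : ℕ} (y : Fin n → R) (χ : Fin n → ℤˣ) : R :=
  (List.ofFn fun i => 1 + (χ i : ℤ) • y i).prod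

theorem signedProd_succ {R : Type*} [Ring R] {n : ℕ} (y : Fin (n + 1) → R)
    (χ : Fin (n + 1) → ℤˣ) :
    signedProd y χ = (1 + (χ 0 : ℤ) • y 0) * signedProd (fun i => y i.succ) fun i => χ i.succ := by
  simp [signedProd, List.ofFn_succ]

theorem sum_signedProd {R : Type*} [Ring R] {n : ℕ} (y : Fin n → R) :
    ∑ χ : Fin n → ℤˣ, signedProd y χ = 2 ^ n := by
  induction n with
  | zero => simp [signedProd]
  | succ n ih =>
    have hunits : (Finset.univ : Finset ℤˣ) = {1, -1} := rfl
    rw [← (Fin.consEquiv fun _ => ℤˣ).sum_comp, Fintype.sum_prod_type]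
    simp only [signedProd_succ, Fin.consEquiv_apply, Fin.cons_zero, Fin.cons_succ]
    simp only [← Finset.mul_sum, ih fun i => y i.succ, hunits]
    rw [Finset.sum_pair (by decide), ← add_mul, pow_succ']
    congr 1
    simp only [Units.val_one, Units.val_neg, one_smul, neg_smul]
    rw [← one_add_one_eq_two]
    abel

theorem signedProd_mul {R : Type*} [Ring R] {n : ℕ} {y : Fin n → R} (χ : Fin n → ℤˣ)
    (hcomm : ∀ i j, Commute (y i) (y j)) {j : Fin n} (hj : y j * y j = 1) :
    signedProd y χ * y j = (χ j : ℤ) • signedProd y χ := by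
  refine list_prod_mul_eq_smul (e := 1 + (χ j : ℤ) • y j) ((List.mem_ofFn' _ _).2 ⟨j, rfl⟩) ?_ ?_
  · intro x hx
    obtain ⟨i, rfl⟩ := (List.mem_ofFn' _ _).1 hx
    exact (Commute.one_left _).add_left ((hcomm i j).smul_left _)
  · rcases Int.units_eq_one_or (χ j) with h | h <;> simp [h, add_mul, hj] <;> abel

theorem map_signedProd {M N : Type*} [AddCommGroup M] [AddCommGroup N] {n : ℕ}
    {y : Fin n → Module.End ℤ M} {z : Fin n → Module.End ℤ N} (f : M →ₗ[ℤ] N)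
    (hf : ∀ i v, f (y i v) = z i (f v)) (χ : Fin n → ℤˣ) (v : M) :
    f (signedProd y χ v) = signedProd z χ (f v) := by
  induction n with
  | zero => simp [signedProd]
  | succ n ih =>
    rw [signedProd_succ, signedProd_succ, Module.End.mul_apply, Module.End.mul_apply,
      ← ih fun i v => hf i.succ v]
    simp [hf]

theorem signedProd_smul_one {R : Type*} [Ring R] {n : ℕ} (ε χ : Fin n → ℤˣ) :
    signedProd (fun i => (ε i : ℤ) • (1 : R)) χ = if χ = ε then 2 ^ n else 0 := by
  induction n with
  | zero => simp [signedProd, Subsingleton.elim χ ε]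
  | succ n ih =>
    rw [signedProd_succ, ih (fun i => ε i.succ) fun i => χ i.succ]
    have hiff : χ = ε ↔ χ 0 = ε 0 ∧ (fun i : Fin n => χ i.succ) = fun i => ε i.succ := by
      simp only [funext_iff, Fin.forall_fin_succ]
    by_cases h : (fun i : Fin n => χ i.succ) = fun i => ε i.succ
    · rcases Int.units_eq_one_or (χ 0) with h0 | h0 <;>
      rcases Int.units_eq_one_or (ε 0) with h1 | h1 <;>
      simp [hiff, h, h0, h1, pow_succ', one_add_one_eq_two]
    · simp [hiff, h]

end SignedProducts

theorem exists_dual_eq_one_of_primitive {L : Type*} [AddCommGroup L] [Module.Finite ℤ L]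
    [Module.Free ℤ L] {u : L} (hu : ∀ (k : ℤ) (x : L), u = k • x → k = 1 ∨ k = -1) :
    ∃ f : L →ₗ[ℤ] ℤ, f u = 1 := by
  let I : Ideal ℤ := LinearMap.range (Module.Dual.eval ℤ L u)
  let d := Submodule.IsPrincipal.generator I
  have hd : ∀ f : L →ₗ[ℤ] ℤ, d ∣ f u := fun f =>
    (Submodule.IsPrincipal.mem_iff_generator_dvd I).1 ⟨f, rfl⟩
  let B := Module.Free.chooseBasis ℤ L
  choose c hc using fun i => hd (B.coord i)
  obtain ⟨f, hf⟩ : d ∈ I := Submodule.IsPrincipal.generator_mem I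
  have hdvd : u = d • ∑ i, c i • B i := by
    conv_lhs => rw [← B.sum_repr u]
    rw [Finset.smul_sum]
    refine Finset.sum_congr rfl fun i _ => ?_
    rw [smul_smul, ← hc i, Module.Basis.coord_apply]
  have hf : f u = d := hf
  rcases hu d _ hdvd with h | h
  · exact ⟨f, hf.trans h⟩
  · exact ⟨-f, by simp [hf, h]⟩

section Squares

theorem squareSubgroup_eq_closure (G : Type*) [Group G] :
    squareSubgroup G = Subgroup.closure {x : G | ∃ g : G, g ^ 2 = x} := by
  rw [squareSubgroup, Subgroup.normalClosure]
  refine congrArg Subgroup.closure (Set.Subset.antisymm ?_ Group.subset_conjugatesOfSet)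
  intro x hx
  obtain ⟨_, ⟨g, rfl⟩, hg⟩ := Group.mem_conjugatesOfSet_iff.1 hx
  obtain ⟨c, rfl⟩ := isConj_iff.1 hg
  exact ⟨c * g * c⁻¹, conj_pow⟩

theorem sq_mem_squareSubgroup {G : Type*} [Group G] (g : G) : g ^ 2 ∈ squareSubgroup G :=
  Subgroup.subset_normalClosure ⟨g, rfl⟩

theorem map_squareSubgroup {F G : Type*} [Group F] [Group G] {π : F →* G}
    (hπ : Function.Surjective π) : (squareSubgroup F).map π = squareSubgroup G := by
  rw [squareSubgroup_eq_closure, squareSubgroup_eq_closure, MonoidHom.map_closure]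
  congr 1
  ext x
  constructor
  · rintro ⟨_, ⟨g, rfl⟩, rfl⟩
    exact ⟨π g, (map_pow _ _ _).symm⟩
  · rintro ⟨g, rfl⟩
    obtain ⟨g, rfl⟩ := hπ g
    exact ⟨g ^ 2, ⟨g, rfl⟩, map_pow _ _ _⟩

theorem quotient_squareSubgroup_mul_self {G : Type*} [Group G] (c : G ⧸ squareSubgroup G) :
    c * c = 1 := by
  induction c using QuotientGroup.induction_on with
  | H g =>
    rw [← sq, ← QuotientGroup.mk_pow, QuotientGroup.eq_one_iff]
    exact sq_mem_squareSubgroup g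

theorem quotient_squareSubgroup_commute {G : Type*} [Group G] (c d : G ⧸ squareSubgroup G) :
    Commute c d := by
  have inv_eq : ∀ c : G ⧸ squareSubgroup G, c⁻¹ = c := fun c =>
    inv_eq_of_mul_eq_one_left (quotient_squareSubgroup_mul_self c)
  rw [Commute, SemiconjBy, ← inv_eq (c * d), mul_inv_rev, inv_eq, inv_eq]

theorem commutator_mem_squareSubgroup {G : Type*} [Group G] (x y : G) :
    x * y * x⁻¹ * y⁻¹ ∈ squareSubgroup G := by
  rw [← QuotientGroup.eq_one_iff]
  simp only [QuotientGroup.mk_mul, QuotientGroup.mk_inv]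
  rw [(quotient_squareSubgroup_commute (x : G ⧸ squareSubgroup G) y).eq]
  group

end Squares

section Retraction

variable {G : Type*} [Group G] {φ : G → ℤ} {χ : G →* ℤˣ}

theorem map_sq_mul_of_equivariant
    (hmul : ∀ x ∈ squareSubgroup G, ∀ y ∈ squareSubgroup G, φ (x * y) = φ x + φ y)
    (hconj : ∀ g, ∀ x ∈ squareSubgroup G, φ (g * x * g⁻¹) = χ g * φ x)
    {x y : G} (hx : χ x = 1) (hy : χ y = 1) :
    φ ((x * y) ^ 2) = φ (x ^ 2) + φ (y ^ 2) := by
  have hQ : (squareSubgroup G).Normal := inferInstance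
  have hone : φ 1 = 0 := by simpa using hmul 1 (one_mem _) 1 (one_mem _)
  have hc := commutator_mem_squareSubgroup y x
  have hy2 := sq_mem_squareSubgroup y
  have hy2' := inv_mem hy2
  have hinv : φ (y ^ 2) + φ (y ^ 2)⁻¹ = 0 := by
    rw [← hmul _ hy2 _ hy2', mul_inv_cancel, hone]
  have hcomm : φ (y * x * y⁻¹ * x⁻¹) = 0 := by
    have h1 : φ (y ^ 2 * (x * (y ^ 2)⁻¹ * x⁻¹)) = 0 := by
      rw [hmul _ hy2 _ (hQ.conj_mem _ hy2' x), hconj _ _ hy2', hx]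
      simpa using hinv
    have h2 : y ^ 2 * (x * (y ^ 2)⁻¹ * x⁻¹) =
        y * (y * x * y⁻¹ * x⁻¹) * y⁻¹ * (y * x * y⁻¹ * x⁻¹) := by simp only [sq]; group
    rw [h2, hmul _ (hQ.conj_mem _ hc y) _ hc, hconj _ _ hc, hy] at h1
    simp only [Units.val_one, one_mul] at h1
    omega
  have h3 : (x * y) ^ 2 = x * (y * x * y⁻¹ * x⁻¹) * x⁻¹ * (x ^ 2 * y ^ 2) := by
    simp only [sq]; group
  have hx2 := sq_mem_squareSubgroup x
  rw [h3, hmul _ (hQ.conj_mem _ hc x) _ (mul_mem hx2 hy2), hconj _ _ hc, hcomm,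
    hmul _ hx2 _ hy2]
  simp

theorem conj_zpow_of_inverts {a b : G} (hba : b * a * b⁻¹ = a⁻¹) (m : ℤ) :
    b * a ^ m = a ^ (-m) * b := by
  rw [← mul_inv_eq_iff_eq_mul, ← conj_zpow, hba, inv_zpow, zpow_neg]

theorem exists_retraction_of_equivariant
    (hmul : ∀ x ∈ squareSubgroup G, ∀ y ∈ squareSubgroup G, φ (x * y) = φ x + φ y)
    (hconj : ∀ g, ∀ x ∈ squareSubgroup G, φ (g * x * g⁻¹) = χ g * φ x)
    {a b : G} (hb2 : b ^ 2 = 1) (hba : b * a * b⁻¹ = a⁻¹) (hφ : φ (a ^ 2) = 1) :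
    ∃ ρ : G →* G, ρ a = a ∧ ρ b = b ∧ ∀ g, ρ g ∈ Subgroup.closure {a, b} := by
  have hone : φ 1 = 0 := by simpa using hmul 1 (one_mem _) 1 (one_mem _)
  have ha2 := sq_mem_squareSubgroup a
  have hinv : φ (a ^ 2)⁻¹ = -1 := by
    have h := hmul _ ha2 _ (inv_mem ha2)
    rw [mul_inv_cancel, hone, hφ] at h
    omega
  have hχa : χ a = 1 := by
    have h := hconj a _ ha2
    rw [show a * a ^ 2 * a⁻¹ = a ^ 2 by group, hφ] at h
    exact Units.ext (by simpa using h.symm)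
  have hχb : χ b = -1 := by
    have h := hconj b _ ha2
    rw [← conj_pow, hba, inv_pow, hinv, hφ] at h
    exact Units.ext (by simpa using h.symm)
  have hb : b * b = 1 := by rwa [← sq]
  have hb' : b⁻¹ = b := inv_eq_of_mul_eq_one_left hb
  have hne : (-1 : ℤˣ) ≠ 1 := by decide
  have hr := fun {x y : G} => map_sq_mul_of_equivariant (x := x) (y := y) hmul hconj
  have hrb : ∀ x, φ ((b * x * b) ^ 2) = -φ (x ^ 2) := by
    intro x
    have h := hconj b _ (sq_mem_squareSubgroup x)
    rw [← conj_pow, hχb, hb'] at h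
    simpa using h
  let f : G → G := fun g => if χ g = 1 then a ^ φ (g ^ 2) else a ^ φ ((g * b) ^ 2) * b
  have f_pos : ∀ {g}, χ g = 1 → f g = a ^ φ (g ^ 2) := fun h => if_pos h
  have f_neg : ∀ {g}, χ g = -1 → f g = a ^ φ ((g * b) ^ 2) * b := fun h => if_neg (by
    rw [h]; exact hne)
  have hχmul : ∀ {g}, χ g = -1 → χ (g * b) = 1 := fun h => by rw [map_mul, h, hχb]; rfl
  refine ⟨MonoidHom.mk' f ?_, ?_, ?_, ?_⟩
  · intro x y
    rcases Int.units_eq_one_or (χ x) with hx | hx <;>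
    rcases Int.units_eq_one_or (χ y) with hy | hy
    · rw [f_pos hx, f_pos hy, f_pos (by simp [hx, hy]), hr hx hy, zpow_add]
    · rw [f_pos hx, f_neg hy, f_neg (by simp [hx, hy]), mul_assoc x, hr hx (hχmul hy), zpow_add,
        mul_assoc]
    · rw [f_neg hx, f_pos hy, f_neg (by simp [hx, hy]), mul_assoc (a ^ _),
        conj_zpow_of_inverts hba, ← mul_assoc, ← zpow_add, ← hrb,
        ← hr (hχmul hx) (by simp [hχb, hy])]
      congr 4
      simp only [mul_assoc, ← mul_assoc b b, hb, one_mul]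
    · rw [f_neg hx, f_neg hy, f_pos (by simp [hx, hy]), mul_assoc (a ^ _), ← mul_assoc b,
        conj_zpow_of_inverts hba, mul_assoc (a ^ _) b b, hb, mul_one, ← zpow_add, ← hrb,
        ← hr (hχmul hx) (by simp [hχb, hy])]
      congr 3
      simp only [mul_assoc, ← mul_assoc b b, hb, one_mul, mul_one]
  · change f a = a
    rw [f_pos hχa, hφ, zpow_one]
  · change f b = b
    rw [f_neg hχb, hb, one_pow, hone, zpow_zero, one_mul]
  · intro g
    have ha' : a ∈ Subgroup.closure {a, b} := Subgroup.subset_closure (by simp)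
    have hb' : b ∈ Subgroup.closure {a, b} := Subgroup.subset_closure (by simp)
    change f g ∈ _
    rcases Int.units_eq_one_or (χ g) with h | h
    · rw [f_pos h]
      exact zpow_mem ha' _
    · rw [f_neg h]
      exact mul_mem (zpow_mem ha' _) hb'

theorem verballyClosedIn_of_retraction {H : Subgroup G} (ρ : G →* G) (hρ : ∀ g, ρ g ∈ H)
    (hH : ∀ h ∈ H, ρ h = h) : VerballyClosedIn G H := by
  rintro n w h hh ⟨g, hg⟩
  refine ⟨fun i => ρ (g i), fun i => hρ _, ?_⟩
  have : FreeGroup.lift (fun i => ρ (g i)) = ρ.comp (FreeGroup.lift g) := by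
    ext i; simp
  rw [this, MonoidHom.comp_apply, hg, hH h hh]

end Retraction

section Projections

variable {G : Type*} [Group G]

/-- The action of `G ⧸ Q` on `Q / [Q, Q]`, written additively, by `ℤ`-linear endomorphisms. -/
def quotientEnd (σ : (G ⧸ squareSubgroup G) →* MulAut (Abelianization ↥(squareSubgroup G))) :
    (G ⧸ squareSubgroup G) →*
      Module.End ℤ (Additive (Abelianization ↥(squareSubgroup G))) where
  toFun c := (MonoidHom.toAdditive (σ c).toMonoidHom).toIntLinearMap
  map_one' := by ext x; simp
  map_mul' c d := by ext x; simp

variable (σ : (G ⧸ squareSubgroup G) →* MulAut (Abelianization ↥(squareSubgroup G)))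

theorem tensorAction_eq_lTensor (c : G ⧸ squareSubgroup G) :
    tensorAction σ c = (quotientEnd σ c).lTensor ℚ := rfl

theorem quotientEnd_ofMul (c : G ⧸ squareSubgroup G)
    (q : Abelianization ↥(squareSubgroup G)) :
    quotientEnd σ c (Additive.ofMul q) = Additive.ofMul (σ c q) := rfl

theorem tensorAction_mul (c d : G ⧸ squareSubgroup G) :
    (tensorAction σ (c * d) : Module.End ℤ _) = tensorAction σ c * tensorAction σ d := by
  rw [tensorAction_eq_lTensor, map_mul]
  exact LinearMap.lTensor_mul _ _ _

theorem tensorAction_one : (tensorAction σ 1 : Module.End ℤ _) = 1 := by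
  rw [tensorAction_eq_lTensor, map_one]
  exact LinearMap.lTensor_id _ _

variable [Fintype (G ⧸ squareSubgroup G)]

theorem eigenProjection_eq (χ : (G ⧸ squareSubgroup G) →* ℤˣ)
    (v : ℚ ⊗[ℤ] Additive (Abelianization ↥(squareSubgroup G))) :
    eigenProjection σ χ v = ((2 : ℚ) ^ Nat.card (G ⧸ squareSubgroup G))⁻¹ •
      ((Finset.univ.toList.map fun c =>
        1 + (χ c : ℤ) • (tensorAction σ c : Module.End ℤ _)).prod v) := by
  rw [eigenProjection]
  congr 1
  induction (Finset.univ : Finset (G ⧸ squareSubgroup G)).toList with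
  | nil => simp
  | cons c l ih =>
    rw [List.foldr_cons, ih, List.map_cons, List.prod_cons, Module.End.mul_apply]
    simp [Int.cast_smul_eq_zsmul]

theorem eigenProjection_tensorAction (χ : (G ⧸ squareSubgroup G) →* ℤˣ)
    (c : G ⧸ squareSubgroup G)
    (v : ℚ ⊗[ℤ] Additive (Abelianization ↥(squareSubgroup G))) :
    eigenProjection σ χ (tensorAction σ c v) = (χ c : ℤ) • eigenProjection σ χ v := by
  rw [eigenProjection_eq, eigenProjection_eq, ← Module.End.mul_apply,
    list_prod_mul_eq_smul (e := 1 + (χ c : ℤ) • (tensorAction σ c : Module.End ℤ _))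
      (s := χ c) (List.mem_map.2 ⟨c, by simp, rfl⟩)]
  · rw [LinearMap.smul_apply, smul_comm]
  · intro x hx
    obtain ⟨d, -, rfl⟩ := List.mem_map.1 hx
    refine (Commute.one_left _).add_left (Commute.smul_left ?_ _)
    rw [Commute, SemiconjBy, ← tensorAction_mul, ← tensorAction_mul,
      (quotient_squareSubgroup_commute d c).eq]
  · have h : (tensorAction σ c : Module.End ℤ _) * tensorAction σ c = 1 := by
      rw [← tensorAction_mul, quotient_squareSubgroup_mul_self, tensorAction_one]
    rcases Int.units_eq_one_or (χ c) with hc | hc <;>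
    simp only [hc, add_mul, Units.val_one, Units.val_neg, one_smul, neg_smul, neg_mul, h, one_mul,
      smul_add, neg_neg, smul_neg] <;> abel

/-- An operator that is `χ`-equivariant does not distinguish `v` from its projection to the
`χ`-eigenspace. -/
theorem apply_eigenProjection {M : Type*} [AddCommGroup M] [Module ℚ M]
    (χ : (G ⧸ squareSubgroup G) →* ℤˣ)
    (f : ℚ ⊗[ℤ] Additive (Abelianization ↥(squareSubgroup G)) →+ M)
    (hf : ∀ c v, f (tensorAction σ c v) = (χ c : ℤ) • f v)
    (v : ℚ ⊗[ℤ] Additive (Abelianization ↥(squareSubgroup G))) :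
    f (eigenProjection σ χ v) = f v := by
  have hlist : ∀ l : List (G ⧸ squareSubgroup G), f (l.foldr
      (fun c w => w + ((χ c : ℤ) : ℚ) • tensorAction σ c w) v) = (2 : ℚ) ^ l.length • f v := by
    intro l
    induction l with
    | nil => simp
    | cons c l ih =>
      rw [List.foldr_cons, map_add, Int.cast_smul_eq_zsmul, map_zsmul, hf, ih,
        List.length_cons, pow_succ', mul_smul (2 : ℚ), two_smul ℚ]
      rcases Int.units_eq_one_or (χ c) with hc | hc <;> simp [hc]
  rw [eigenProjection, map_rat_smul, hlist, Finset.length_toList, Finset.card_univ,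
    ← Nat.card_eq_fintype_card, inv_smul_smul₀]
  positivity

/-- The map `q ↦ p_χ (1 ⊗ q)`. -/
noncomputable def eigenProjectionHom (χ : (G ⧸ squareSubgroup G) →* ℤˣ) :
    Additive (Abelianization ↥(squareSubgroup G)) →ₗ[ℤ]
      ℚ ⊗[ℤ] Additive (Abelianization ↥(squareSubgroup G)) where
  toFun q := eigenProjection σ χ (1 ⊗ₜ[ℤ] q)
  map_add' x y := by simp only [eigenProjection_eq, TensorProduct.tmul_add, map_add, smul_add]
  map_smul' k x := by
    simp only [eigenProjection_eq, TensorProduct.tmul_smul, map_zsmul, RingHom.id_apply]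
    rw [smul_comm]

theorem eigenProjectionHom_quotientEnd (χ : (G ⧸ squareSubgroup G) →* ℤˣ)
    (c : G ⧸ squareSubgroup G) (q : Additive (Abelianization ↥(squareSubgroup G))) :
    eigenProjectionHom σ χ (quotientEnd σ c q) = (χ c : ℤ) • eigenProjectionHom σ χ q :=
  eigenProjection_tensorAction σ χ c (1 ⊗ₜ[ℤ] q)

theorem finite_additive_abelianization [Group.FG G] :
    Module.Finite ℤ (Additive (Abelianization ↥(squareSubgroup G))) := by
  have : (squareSubgroup G).FiniteIndex := Subgroup.finiteIndex_of_finite_quotient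
  have : Group.FG (Abelianization ↥(squareSubgroup G)) :=
    Group.fg_of_surjective (f := Abelianization.of) (QuotientGroup.mk'_surjective _)
  exact Module.Finite.iff_addGroup_fg.2 (GroupFG.iff_add_fg.1 this)

theorem IsSimpleElement.exists_functional [Group.FG G]
    {q : Abelianization ↥(squareSubgroup G)} (hq : IsSimpleElement σ q) :
    ∃ (χ : (G ⧸ squareSubgroup G) →* ℤˣ)
      (f : Additive (Abelianization ↥(squareSubgroup G)) →ₗ[ℤ] ℤ),
      f (Additive.ofMul q) = 1 ∧ ∀ c v, f (quotientEnd σ c v) = χ c * f v := by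
  obtain ⟨χ, hχ⟩ := hq
  have := finite_additive_abelianization (G := G)
  let P := eigenProjectionHom σ χ
  have : Module.IsTorsionFree ℤ (ℚ ⊗[ℤ] Additive (Abelianization ↥(squareSubgroup G))) :=
    Module.IsTorsionFree.trans ℚ
  have : Module.Free ℤ (LinearMap.range P) := Module.free_of_finite_type_torsion_free'
  obtain ⟨f, hf⟩ := exists_dual_eq_one_of_primitive (u := P.rangeRestrict (Additive.ofMul q)) (by
    rintro k ⟨_, x, rfl⟩ hx
    exact hχ k ⟨x.toMul, congrArg Subtype.val hx⟩)
  refine ⟨χ, f ∘ₗ P.rangeRestrict, hf, fun c v => ?_⟩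
  have h : P.rangeRestrict (quotientEnd σ c v) = (χ c : ℤ) • P.rangeRestrict v :=
    Subtype.ext (eigenProjectionHom_quotientEnd σ χ c v)
  rw [LinearMap.comp_apply, h, map_smul, smul_eq_mul, LinearMap.comp_apply]

theorem verballyClosedIn_of_isSimpleElement [Group.FG G] {a b : G} (hb2 : b ^ 2 = 1)
    (hba : b * a * b⁻¹ = a⁻¹)
    (hσ : ∀ (g : G) (q : squareSubgroup G),
      σ (QuotientGroup.mk g) (Abelianization.of q) =
        Abelianization.of
          ⟨g * (q : G) * g⁻¹, Subgroup.normalClosure_normal.conj_mem _ q.2 g⟩)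
    (h : IsSimpleElement σ (Abelianization.of ⟨a ^ 2, sq_mem_squareSubgroup a⟩)) :
    VerballyClosedIn G (Subgroup.closure {a, b}) := by
  classical
  obtain ⟨χ, f, hf1, hf⟩ := h.exists_functional
  let φ : G → ℤ := fun g =>
    if hg : g ∈ squareSubgroup G then f (Additive.ofMul (Abelianization.of ⟨g, hg⟩)) else 0
  have hφ : ∀ g (hg : g ∈ squareSubgroup G),
      φ g = f (Additive.ofMul (Abelianization.of ⟨g, hg⟩)) := fun g hg => dif_pos hg
  obtain ⟨ρ, hρa, hρb, hρ⟩ := exists_retraction_of_equivariant (φ := φ)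
    (χ := χ.comp (QuotientGroup.mk' (squareSubgroup G))) (a := a) (b := b) (by
      intro x hx y hy
      rw [hφ x hx, hφ y hy, hφ _ (mul_mem hx hy), ← map_add, ← ofMul_mul, ← map_mul]
      rfl) (by
      intro g x hx
      rw [hφ x hx, hφ _ (Subgroup.normalClosure_normal.conj_mem _ hx g), ← hσ g ⟨x, hx⟩,
        ← quotientEnd_ofMul, hf]
      rfl) hb2 hba ((hφ _ (sq_mem_squareSubgroup a)).trans hf1)
  refine verballyClosedIn_of_retraction ρ hρ fun h hh => ?_
  have hle : Subgroup.closure {a, b} ≤ ρ.eqLocus (MonoidHom.id G) := by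
    rw [Subgroup.closure_le]
    rintro x (rfl | rfl)
    exacts [hρa, hρb]
  exact hle hh

end Projections

section Functionals

theorem mem_dihedral_cases {G : Type*} [Group G] {a b : G} (hb2 : b ^ 2 = 1)
    (hba : b * a * b⁻¹ = a⁻¹) {h : G} (hh : h ∈ Subgroup.closure {a, b}) :
    ∃ m : ℤ, h = a ^ m ∨ h = a ^ m * b := by
  have hbb : b * b = 1 := by rwa [← sq]
  have hb' : b⁻¹ = b := inv_eq_of_mul_eq_one_left hbb
  have hz := conj_zpow_of_inverts hba
  induction hh using Subgroup.closure_induction with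
  | mem x hx =>
    rcases hx with rfl | rfl
    · exact ⟨1, by simp⟩
    · exact ⟨0, by simp⟩
  | one => exact ⟨0, by simp⟩
  | mul x y _ _ hx hy =>
    obtain ⟨m, rfl | rfl⟩ := hx <;> obtain ⟨k, rfl | rfl⟩ := hy
    · exact ⟨m + k, .inl (zpow_add _ _ _).symm⟩
    · exact ⟨m + k, .inr (by rw [zpow_add, mul_assoc])⟩
    · exact ⟨m - k, .inr (by rw [mul_assoc, hz, ← mul_assoc, ← zpow_add, sub_eq_add_neg])⟩
    · refine ⟨m - k, .inl ?_⟩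
      rw [mul_assoc, ← mul_assoc b, hz, mul_assoc, hbb, mul_one, ← zpow_add, sub_eq_add_neg]
  | inv x _ hx =>
    obtain ⟨m, rfl | rfl⟩ := hx
    · exact ⟨-m, .inl (zpow_neg _ _).symm⟩
    · refine ⟨m, .inr ?_⟩
      rw [mul_inv_rev, hb', ← zpow_neg, hz, neg_neg]

theorem conj_zpow_of_mem_dihedral {G : Type*} [Group G] {a b : G} (hb2 : b ^ 2 = 1)
    (hba : b * a * b⁻¹ = a⁻¹) {h : G} (hh : h ∈ Subgroup.closure {a, b}) :
    ∃ ε : ℤˣ, ∀ k : ℤ, h * a ^ k * h⁻¹ = a ^ (ε * k : ℤ) := by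
  obtain ⟨m, rfl | rfl⟩ := mem_dihedral_cases hb2 hba hh
  · refine ⟨1, fun k => ?_⟩
    rw [← zpow_add, ← zpow_neg, ← zpow_add]
    congr 1
    simp
  · refine ⟨-1, fun k => ?_⟩
    rw [mul_assoc (a ^ m), conj_zpow_of_inverts hba, mul_inv_rev, ← mul_assoc,
      ← mul_assoc (a ^ m), mul_inv_cancel_right, ← zpow_add, ← zpow_neg, ← zpow_add]
    congr 1
    simp

theorem sq_mem_zpowers_of_mem_dihedral {G : Type*} [Group G] {a b : G} (hb2 : b ^ 2 = 1)
    (hba : b * a * b⁻¹ = a⁻¹) {h : G} (hh : h ∈ Subgroup.closure {a, b}) :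
    h ^ 2 ∈ Subgroup.zpowers (a ^ 2) := by
  obtain ⟨m, rfl | rfl⟩ := mem_dihedral_cases hb2 hba hh
  · exact ⟨m, by simp only [← zpow_natCast, ← zpow_mul, mul_comm]⟩
  · refine ⟨0, ?_⟩
    have hb : b * b = 1 := by rwa [← sq]
    simp only [zpow_zero]
    rw [sq, mul_assoc, ← mul_assoc b, conj_zpow_of_inverts hba, mul_assoc (a ^ (-m)), hb, mul_one,
      ← zpow_add, add_neg_cancel, zpow_zero]

/-- Conjugation by an element of `F` on the abelianization of a normal subgroup, written
additively. -/
def conjAbelianization {F : Type*} [Group F] (N : Subgroup F) [N.Normal] (w : F) :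
    Module.End ℤ (Additive (Abelianization N)) :=
  (MonoidHom.toAdditive
    (Abelianization.map (MulAut.conjNormal (H := N) w).toMonoidHom)).toIntLinearMap

theorem conjAbelianization_of {F : Type*} [Group F] (N : Subgroup F) [N.Normal] (w : F) (q : N) :
    conjAbelianization N w (Additive.ofMul (Abelianization.of q)) =
      Additive.ofMul (Abelianization.of (MulAut.conjNormal w q)) := rfl

theorem abelianization_linearMap_ext {N : Type*} [Group N] {M : Type*} [AddCommGroup M]
    {f g : Additive (Abelianization N) → M}
    (h : ∀ q : N, f (Additive.ofMul (Abelianization.of q)) =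
      g (Additive.ofMul (Abelianization.of q))) (v) : f v = g v := by
  obtain ⟨q, hq⟩ := QuotientGroup.mk'_surjective _ v.toMul
  have hv : v = Additive.ofMul (Abelianization.of q) := congrArg Additive.ofMul hq.symm
  rw [hv, h]

/-- A homomorphism from `F` to an infinite dihedral group `⟨a, b⟩` maps the subgroup `Q`
generated by the squares of `F` to the infinite cyclic group `⟨a ^ 2⟩`; this gives a functional
on `Q / [Q, Q]` on which `F` acts by signs. -/
theorem exists_functional_of_hom {F G : Type*} [Group F] [Group G] {a b : G} (hb2 : b ^ 2 = 1)
    (hba : b * a * b⁻¹ = a⁻¹) (ha : ∀ n : ℤ, n ≠ 0 → a ^ n ≠ 1) {ρ : F →* G}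
    (hρ : ∀ w, ρ w ∈ Subgroup.closure {a, b}) :
    ∃ (ε : F → ℤˣ) (r : Additive (Abelianization (squareSubgroup F)) →ₗ[ℤ] ℤ),
      (∀ q : squareSubgroup F,
        ρ q = a ^ (2 * r (Additive.ofMul (Abelianization.of q)))) ∧
      ∀ w v, r (conjAbelianization _ w v) = ε w * r v := by
  choose ε hε using fun w => conj_zpow_of_mem_dihedral hb2 hba (hρ w)
  have hinj : ∀ m k : ℤ, a ^ (2 * m) = a ^ (2 * k) → m = k := by
    intro m k h
    by_contra hne
    refine ha (2 * m - 2 * k) (by omega) ?_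
    rw [zpow_sub, h, mul_inv_cancel]
  have hle : squareSubgroup F ≤ (Subgroup.zpowers (a ^ 2)).comap ρ := by
    rw [squareSubgroup_eq_closure, Subgroup.closure_le]
    rintro _ ⟨w, rfl⟩
    rw [SetLike.mem_coe, Subgroup.mem_comap, map_pow]
    exact sq_mem_zpowers_of_mem_dihedral hb2 hba (hρ w)
  have hexists : ∀ q : squareSubgroup F, ∃ m : ℤ, ρ q = a ^ (2 * m) := by
    intro q
    obtain ⟨m, hm⟩ := hle q.2
    exact ⟨m, by simp only [← hm, zpow_mul, zpow_ofNat]⟩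
  choose s hs using hexists
  let S : squareSubgroup F →* Multiplicative ℤ := MonoidHom.mk' (fun q => Multiplicative.ofAdd (s q))
    fun q q' => by
      rw [← ofAdd_add]
      refine congrArg _ (hinj _ _ ?_)
      rw [← hs, Subgroup.coe_mul, map_mul, hs, hs, ← zpow_add, mul_add]
  let r : Additive (Abelianization (squareSubgroup F)) →ₗ[ℤ] ℤ :=
    (MonoidHom.toAdditiveLeft (Abelianization.lift S)).toIntLinearMap
  have hr : ∀ q, r (Additive.ofMul (Abelianization.of q)) = s q := fun q => rfl
  refine ⟨ε, r, fun q => by rw [hr, hs], fun w v => ?_⟩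
  refine abelianization_linearMap_ext (f := fun v => r (conjAbelianization _ w v))
    (g := fun v => ε w * r v) (fun q => ?_) v
  simp only [conjAbelianization_of, hr]
  apply hinj
  rw [← hs, MulAut.conjNormal_apply, map_mul, map_mul, map_inv, hs q, hε]
  congr 1
  ring

end Functionals

section VerballyClosed

theorem exists_lift_of_abelianization_map_eq {N M : Type*} [Group N] [Group M] {f : N →* M}
    (hf : Function.Surjective f) {x : Abelianization N} {m : M}
    (h : Abelianization.map f x = Abelianization.of m) :
    ∃ q : N, Abelianization.of q = x ∧ f q = m := by
  obtain ⟨q, rfl⟩ := QuotientGroup.mk'_surjective _ x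
  have hmem : (f q)⁻¹ * m ∈ commutator M := QuotientGroup.eq.1 h
  have hmap : (commutator N).map f = commutator M := by
    rw [commutator_def, commutator_def, Subgroup.map_commutator,
      Subgroup.map_top_of_surjective f hf]
  rw [← hmap] at hmem
  obtain ⟨c, hc, hfc⟩ := hmem
  refine ⟨q * c, QuotientGroup.eq.2 ?_, by rw [map_mul, hfc, mul_inv_cancel_left]⟩
  rw [mul_inv_rev, inv_mul_cancel_right]
  exact inv_mem hc

variable {G : Type*} [Group G]

/-- The restriction of a surjective homomorphism to the subgroups generated by the squares. -/
def squareSubgroupMap {F : Type*} [Group F] (π : F →* G) (hπ : Function.Surjective π) :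
    squareSubgroup F →* squareSubgroup G :=
  (π.comp (squareSubgroup F).subtype).codRestrict _ fun q =>
    map_squareSubgroup hπ ▸ Subgroup.mem_map_of_mem π q.2

theorem squareSubgroupMap_surjective {F : Type*} [Group F] (π : F →* G)
    (hπ : Function.Surjective π) : Function.Surjective (squareSubgroupMap π hπ) := by
  rintro ⟨g, hg⟩
  rw [← map_squareSubgroup hπ] at hg
  obtain ⟨q, hq, rfl⟩ := hg
  exact ⟨⟨q, hq⟩, rfl⟩

variable (σ : (G ⧸ squareSubgroup G) →* MulAut (Abelianization ↥(squareSubgroup G)))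

/-- The operator `∏ i, (1 + χ i • π xᵢ)` on `Q / [Q, Q]`, for a homomorphism `π` from the free
group on the `xᵢ`. -/
def generatorProd {n : ℕ} (π : FreeGroup (Fin n) →* G) (χ : Fin n → ℤˣ) :
    Module.End ℤ (Additive (Abelianization ↥(squareSubgroup G))) :=
  signedProd (fun i => quotientEnd σ (π (FreeGroup.of i) : G ⧸ squareSubgroup G)) χ

theorem generatorProd_mul_quotientEnd {n : ℕ} (π : FreeGroup (Fin n) →* G) (χ : Fin n → ℤˣ)
    (w : FreeGroup (Fin n)) :
    generatorProd σ π χ * quotientEnd σ (π w : G ⧸ squareSubgroup G) =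
      (FreeGroup.lift χ w : ℤ) • generatorProd σ π χ := by
  have hof : ∀ i, generatorProd σ π χ * quotientEnd σ (π (FreeGroup.of i) : G ⧸ squareSubgroup G) =
      (FreeGroup.lift χ (FreeGroup.of i) : ℤ) • generatorProd σ π χ := by
    intro i
    rw [FreeGroup.lift_apply_of]
    refine signedProd_mul χ (fun i j => ?_) ?_
    · exact (quotient_squareSubgroup_commute _ _).map (quotientEnd σ)
    · rw [← map_mul, quotient_squareSubgroup_mul_self, map_one]
  induction w using FreeGroup.induction_on with
  | C1 => simp
  | of i => exact hof i
  | inv_of i _ =>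
    have h := quotient_squareSubgroup_mul_self (π (FreeGroup.of i) : G ⧸ squareSubgroup G)
    rw [map_inv, map_inv, Int.units_inv_eq_self, QuotientGroup.mk_inv,
      inv_eq_of_mul_eq_one_left h, hof]
  | mul x y hx hy =>
    rw [map_mul, QuotientGroup.mk_mul, map_mul, ← mul_assoc, hx, smul_mul_assoc, hy, smul_smul,
      map_mul, Units.val_mul]

theorem exists_generatorProd_eq_smul [Fintype (G ⧸ squareSubgroup G)] {n : ℕ}
    {π : FreeGroup (Fin n) →* G} (hπ : Function.Surjective π)
    {q : Abelianization ↥(squareSubgroup G)} (hq : ¬IsSimpleElement σ q) (χ : Fin n → ℤˣ) :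
    ∃ (k T : ℤ) (x : Additive (Abelianization ↥(squareSubgroup G))), ¬IsUnit k ∧ T ≠ 0 ∧
      T • generatorProd σ π χ (Additive.ofMul q) = T • k • generatorProd σ π χ x := by
  let s : FreeGroup (Fin n) →* G ⧸ squareSubgroup G := (QuotientGroup.mk' _).comp π
  have hs : Function.Surjective s := (QuotientGroup.mk'_surjective _).comp hπ
  have hE := generatorProd_mul_quotientEnd σ π χ
  by_cases hker : s.ker ≤ (FreeGroup.lift χ).ker
  · let χ' : (G ⧸ squareSubgroup G) →* ℤˣ :=
      s.liftOfRightInverse _ (Function.rightInverse_surjInv hs) ⟨FreeGroup.lift χ, hker⟩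
    have hχ' : ∀ w, χ' (s w) = FreeGroup.lift χ w := fun w =>
      s.liftOfRightInverse_comp_apply _ _ ⟨FreeGroup.lift χ, hker⟩ w
    have hns : ∃ k : ℤ, (∃ x, eigenProjection σ χ' (1 ⊗ₜ[ℤ] Additive.ofMul q) =
        k • eigenProjection σ χ' (1 ⊗ₜ[ℤ] Additive.ofMul x)) ∧ ¬(k = 1 ∨ k = -1) := by
      by_contra! h
      exact hq ⟨χ', fun k hk => by simpa [or_iff_not_imp_left] using h k hk⟩
    obtain ⟨k, ⟨x, hx⟩, hk⟩ := hns
    let f := (generatorProd σ π χ).lTensor ℚ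
    have hf : ∀ c v, f (tensorAction σ c v) = (χ' c : ℤ) • f v := by
      intro c v
      obtain ⟨w, rfl⟩ := hs c
      have h : generatorProd σ π χ ∘ₗ quotientEnd σ (s w) =
        (FreeGroup.lift χ w : ℤ) • generatorProd σ π χ := hE w
      have h' := congrArg (fun g => g.lTensor ℚ v) h
      rw [LinearMap.lTensor_comp, LinearMap.lTensor_smul] at h'
      rw [hχ']
      exact h'
    have happly : ∀ v, f (eigenProjection σ χ' v) = f v :=
      apply_eigenProjection σ χ' f.toAddMonoidHom hf
    have h := congrArg f hx
    rw [map_zsmul, happly, happly, LinearMap.lTensor_tmul, LinearMap.lTensor_tmul,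
      ← TensorProduct.tmul_smul] at h
    obtain ⟨T, hT⟩ := (IsLocalizedModule.eq_iff_exists (nonZeroDivisors ℤ)
      (TensorProduct.mk ℤ ℚ (Additive (Abelianization ↥(squareSubgroup G))) 1)).1 h
    exact ⟨k, T, Additive.ofMul x, by rwa [Int.isUnit_iff], nonZeroDivisors.coe_ne_zero T, hT⟩
  · obtain ⟨w, hw, hχw⟩ := SetLike.not_le_iff_exists.1 hker
    have hw : ((π w : G) : G ⧸ squareSubgroup G) = 1 := hw
    have hχw : FreeGroup.lift χ w = -1 := (Int.units_eq_one_or _).resolve_left hχw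
    have h := hE w
    rw [hw, hχw, map_one, mul_one, Units.val_neg, Units.val_one, neg_smul, one_smul] at h
    refine ⟨0, 2, 0, not_isUnit_zero, two_ne_zero, ?_⟩
    rw [zero_smul, smul_zero, two_smul]
    nth_rewrite 1 [h]
    rw [LinearMap.neg_apply, neg_add_cancel]

theorem isSimpleElement_of_verballyClosedIn [Group.FG G] [Fintype (G ⧸ squareSubgroup G)]
    {a b : G} (hb2 : b ^ 2 = 1) (hba : b * a * b⁻¹ = a⁻¹) (ha : ∀ n : ℤ, n ≠ 0 → a ^ n ≠ 1)
    (hσ : ∀ (g : G) (q : squareSubgroup G),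
      σ (QuotientGroup.mk g) (Abelianization.of q) =
        Abelianization.of
          ⟨g * (q : G) * g⁻¹, Subgroup.normalClosure_normal.conj_mem _ q.2 g⟩)
    (hH : VerballyClosedIn G (Subgroup.closure {a, b})) :
    IsSimpleElement σ (Abelianization.of ⟨a ^ 2, sq_mem_squareSubgroup a⟩) := by
  by_contra hns
  obtain ⟨n, π, hπ⟩ : ∃ (n : ℕ) (π : FreeGroup (Fin n) →* G), Function.Surjective π := by
    obtain ⟨ι, _, π, hπ⟩ := Group.fg_iff_exists_freeGroup_hom_surjective_finite.1 ‹Group.FG G›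
    obtain ⟨n, ⟨e⟩⟩ := Finite.exists_equiv_fin ι
    exact ⟨n, π.comp (FreeGroup.freeGroupCongr e.symm).toMonoidHom,
      hπ.comp (FreeGroup.freeGroupCongr e.symm).surjective⟩
  let πQ := squareSubgroupMap π hπ
  have hπQ : Function.Surjective πQ := squareSubgroupMap_surjective π hπ
  let p : Additive (Abelianization (squareSubgroup (FreeGroup (Fin n)))) →ₗ[ℤ]
      Additive (Abelianization (squareSubgroup G)) :=
    (MonoidHom.toAdditive (Abelianization.map πQ)).toIntLinearMap
  have hp : Function.Surjective p := by
    intro v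
    obtain ⟨q, hq⟩ := QuotientGroup.mk'_surjective _ v.toMul
    obtain ⟨q, rfl⟩ := hπQ q
    exact ⟨Additive.ofMul (Abelianization.of q), congrArg Additive.ofMul hq⟩
  let y : Fin n → Module.End ℤ (Additive (Abelianization (squareSubgroup (FreeGroup (Fin n))))) :=
    fun i => conjAbelianization _ (FreeGroup.of i)
  have hpE : ∀ χ v, p (signedProd y χ v) = generatorProd σ π χ (p v) := by
    intro χ v
    refine map_signedProd p (fun i v => ?_) χ v
    refine abelianization_linearMap_ext (f := fun v => p (y i v))
      (g := fun v => quotientEnd σ _ (p v)) (fun q => ?_) v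
    refine (congrArg Additive.ofMul ?_).trans
      (congrArg Additive.ofMul (hσ (π (FreeGroup.of i)) (πQ q)).symm)
    refine congrArg Abelianization.of (Subtype.ext ?_)
    change π ((MulAut.conjNormal (FreeGroup.of i) q : squareSubgroup _) : FreeGroup (Fin n)) =
      π (FreeGroup.of i) * π q * (π (FreeGroup.of i))⁻¹
    rw [MulAut.conjNormal_apply, map_mul, map_mul, map_inv]
  choose k T x hk hT hx using exists_generatorProd_eq_smul σ hπ hns
  choose X hX using fun χ => hp (x χ)
  let D : ℤ := ∏ χ, T χ
  have hD : D ≠ 0 := Finset.prod_ne_zero_iff.2 fun χ _ => hT χ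
  let A2 : squareSubgroup G := ⟨a ^ 2, sq_mem_squareSubgroup a⟩
  let t := ∑ χ, D • k χ • signedProd y χ (X χ)
  have hpt : p t = Additive.ofMul (Abelianization.of (A2 ^ (D * 2 ^ n))) := by
    have hterm : ∀ χ, p (D • k χ • signedProd y χ (X χ)) =
        D • generatorProd σ π χ (Additive.ofMul (Abelianization.of A2)) := by
      intro χ
      obtain ⟨c, hc⟩ : T χ ∣ D := Finset.dvd_prod_of_mem T (Finset.mem_univ χ)
      rw [map_zsmul, map_zsmul, hpE, hX, hc, mul_comm, mul_smul, mul_smul, hx]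
    have hsum := congrArg (fun f => f (Additive.ofMul (Abelianization.of A2)))
      (sum_signedProd fun i => quotientEnd σ (π (FreeGroup.of i) : G ⧸ squareSubgroup G))
    simp only [LinearMap.sum_apply] at hsum
    rw [map_sum, Finset.sum_congr rfl fun χ _ => hterm χ, ← Finset.smul_sum]
    refine (congrArg (D • ·) hsum).trans ?_
    rw [map_zpow, ofMul_zpow, mul_smul]
    congr 1
    rw [← Nat.cast_ofNat, ← Nat.cast_pow, Module.End.natCast_apply, ← natCast_zsmul]
    norm_cast
  obtain ⟨q, hqt, hq⟩ := exists_lift_of_abelianization_map_eq hπQ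
    (x := t.toMul) (congrArg Additive.toMul hpt)
  have hπq : π q = a ^ (2 * (D * 2 ^ n)) := by
    have h : π q = (a ^ 2) ^ (D * 2 ^ n) := congrArg Subtype.val hq
    rw [h, zpow_mul a, zpow_ofNat]
  have haH : a ∈ Subgroup.closure {a, b} := Subgroup.subset_closure (by simp)
  have hlift : FreeGroup.lift (fun i => π (FreeGroup.of i)) = π := by ext; simp
  obtain ⟨z, hz, hzq⟩ := hH n q (a ^ (2 * (D * 2 ^ n))) (zpow_mem haH _)
    ⟨fun i => π (FreeGroup.of i), by rw [hlift, hπq]⟩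
  have hρ : ∀ w, FreeGroup.lift z w ∈ Subgroup.closure {a, b} := fun w =>
    FreeGroup.range_lift_le (Set.range_subset_iff.2 hz) ⟨w, rfl⟩
  obtain ⟨ε, r, hr, hrε⟩ := exists_functional_of_hom hb2 hba ha hρ
  have hrt : r t = D * 2 ^ n := by
    have h := hr q
    have hqt' : Additive.ofMul (Abelianization.of q) = t := congrArg Additive.ofMul hqt
    rw [hzq, hqt'] at h
    by_contra hne
    refine ha (2 * r t - 2 * (D * 2 ^ n)) (by omega) ?_
    rw [zpow_sub, h, mul_inv_cancel]
  let ε' : Fin n → ℤˣ := fun i => ε (FreeGroup.of i)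
  have hrE : ∀ χ v, r (signedProd y χ v) = if χ = ε' then 2 ^ n * r v else 0 := by
    intro χ v
    rw [map_signedProd (z := fun i => (ε' i : ℤ) • (1 : Module.End ℤ ℤ)) r
      (fun i v => by simp [y, hrε, ε']) χ v, signedProd_smul_one]
    split_ifs
    · rw [← Nat.cast_ofNat, ← Nat.cast_pow, Module.End.natCast_apply]
      simp
    · rfl
  have hrt' : r t = D * (k ε' * (2 ^ n * r (X ε'))) := by
    simp only [t, map_sum, map_smul, hrE, smul_eq_mul]
    rw [Finset.sum_eq_single ε' (fun χ _ h => by simp [h]) (by simp), if_pos rfl]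
  have h2 : (2 : ℤ) ^ n ≠ 0 := by positivity
  refine hk ε' (.of_mul_eq_one (r (X ε')) ?_)
  refine mul_left_cancel₀ h2 (mul_left_cancel₀ hD ?_)
  rw [mul_one, ← hrt, hrt']
  ring

end VerballyClosed

/-- Let G be a finitely generated group, H = ⟨b⟩₂ ⋉ ⟨a⟩∞ an infinite dihedral subgroup
of G, and Q the subgroup of G generated by all squares. Then H is verbally closed in G
if and only if a²[Q,Q] is a simple element of the G/Q-module Q/[Q,Q], where G/Q acts by
conjugation (the action σ being characterised by the hypothesis hσ). -/
theorem dihedral_verballyClosed_iff_simple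
    (G : Type*) [Group G] [Group.FG G] [Fintype (G ⧸ squareSubgroup G)]
    (a b : G) (hb2 : b ^ 2 = 1) (hb1 : b ≠ 1)
    (ha : ∀ n : ℤ, n ≠ 0 → a ^ n ≠ 1) (hba : b * a * b⁻¹ = a⁻¹)
    (σ : (G ⧸ squareSubgroup G) →* MulAut (Abelianization ↥(squareSubgroup G)))
    (hσ : ∀ (g : G) (q : squareSubgroup G),
      σ (QuotientGroup.mk g) (Abelianization.of q) =
        Abelianization.of
          ⟨g * (q : G) * g⁻¹, Subgroup.normalClosure_normal.conj_mem _ q.2 g⟩) :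
    VerballyClosedIn G (Subgroup.closure {a, b}) ↔
      IsSimpleElement σ
        (Abelianization.of ⟨a ^ 2, Subgroup.subset_normalClosure ⟨a, rfl⟩⟩) := by
  exact ⟨isSimpleElement_of_verballyClosedIn σ hb2 hba ha hσ,
    verballyClosedIn_of_isSimpleElement σ hb2 hba hσ⟩
end

section
/- Let C be a finite elementary abelian 2-group. In the group ring ℤ[C], the sum over all characters χ: C → {±1} of the products ∏_{c∈C}(1 + χ(c)c) equals 2^{|C|} times the identity: ∑_{χ: C→{±1}} ∏_{c∈C}(1 + χ(c)c) = 2^{|C|}. -/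
section CharacterProducts

variable {C : Type*} [CommGroup C]

theorem hasEnoughRootsOfUnity_int_exponent (h2 : ∀ c : C, c ^ 2 = 1) :
    HasEnoughRootsOfUnity ℤ (Monoid.exponent C) := by
  have h : HasEnoughRootsOfUnity ℤ 2 :=
    { prim := ⟨-1, IsPrimitiveRoot.neg_one 0 (by norm_num)⟩
      cyc := inferInstance }
  exact HasEnoughRootsOfUnity.of_dvd ℤ (Monoid.exponent_dvd_of_forall_pow_eq_one h2)

theorem mul_prod_eq_pow_card_mul {R ι : Type*} [CommRing R] (s : Finset ι) (f : ι → R) (e a : R)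
    (h : ∀ i ∈ s, e * f i = a * e) : e * ∏ i ∈ s, f i = a ^ s.card * e := by
  classical
  induction s using Finset.induction_on with
  | empty => simp
  | insert i s hi ih =>
    rw [Finset.prod_insert hi, Finset.card_insert_of_notMem hi, ← mul_assoc,
      h i (Finset.mem_insert_self i s), mul_assoc,
      ih fun j hj => h j (Finset.mem_insert_of_mem hj), pow_succ']
    ring

variable [Fintype C]

theorem sum_monoidHom_int_units_of_ne_one [Fintype (C →* ℤˣ)] (h2 : ∀ c : C, c ^ 2 = 1) {c : C}
    (hc : c ≠ 1) : ∑ χ : C →* ℤˣ, (χ c : ℤ) = 0 := by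
  have := hasEnoughRootsOfUnity_int_exponent h2
  obtain ⟨φ, hφ⟩ := CommGroup.exists_apply_ne_one_of_hasEnoughRootsOfUnity C ℤ hc
  have hφc : φ c = -1 := (Int.units_eq_one_or (φ c)).resolve_left hφ
  have h := Fintype.sum_equiv (Equiv.mulLeft φ) (fun χ : C →* ℤˣ => ((φ * χ) c : ℤ))
    (fun χ : C →* ℤˣ => (χ c : ℤ)) fun _ => rfl
  simp only [MonoidHom.mul_apply, hφc, neg_mul, one_mul, Units.val_neg,
    Finset.sum_neg_distrib] at h
  linarith

theorem sum_sum_monoidHom_smul_of [Fintype (C →* ℤˣ)] (h2 : ∀ c : C, c ^ 2 = 1) :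
    ∑ χ : C →* ℤˣ, ∑ c : C, (χ c : ℤ) • MonoidAlgebra.of ℤ C c =
      (Fintype.card C : ℤ) • (1 : MonoidAlgebra ℤ C) := by
  have := hasEnoughRootsOfUnity_int_exponent h2
  have hcard := CommGroup.card_monoidHom_of_hasEnoughRootsOfUnity C ℤ
  rw [Nat.card_eq_fintype_card, Nat.card_eq_fintype_card] at hcard
  rw [Finset.sum_comm]
  simp_rw [← Finset.sum_smul]
  rw [Finset.sum_eq_single 1]
  · simp only [map_one, Units.val_one, Finset.sum_const, Finset.card_univ, hcard, nsmul_eq_mul,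
      mul_one]
  · intro c _ hc
    rw [sum_monoidHom_int_units_of_ne_one h2 hc, zero_smul]
  · simp

theorem Int.units_smul_smul_self {M : Type*} [AddCommGroup M] (u : ℤˣ) (x : M) :
    (u : ℤ) • (u : ℤ) • x = x := by
  rw [smul_smul, ← Units.val_mul, Int.units_mul_self, Units.val_one, one_smul]

theorem sum_smul_of_mul_of (χ : C →* ℤˣ) (c : C) :
    (∑ d : C, (χ d : ℤ) • MonoidAlgebra.of ℤ C d) * MonoidAlgebra.of ℤ C c =
      (χ c : ℤ) • ∑ d : C, (χ d : ℤ) • MonoidAlgebra.of ℤ C d := by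
  rw [Finset.sum_mul, Finset.smul_sum]
  refine Fintype.sum_equiv (Equiv.mulRight c) _ _ fun d => ?_
  rw [Equiv.coe_mulRight, smul_mul_assoc, ← map_mul, map_mul χ, Units.val_mul,
    mul_comm (χ d : ℤ), mul_smul, Int.units_smul_smul_self]

theorem of_mul_prod_one_add_smul_of (h2 : ∀ c : C, c ^ 2 = 1) (χ : C →* ℤˣ) (d : C) :
    MonoidAlgebra.of ℤ C d * ∏ c : C, (1 + (χ c : ℤ) • MonoidAlgebra.of ℤ C c) =
      (χ d : ℤ) • ∏ c : C, (1 + (χ c : ℤ) • MonoidAlgebra.of ℤ C c) := by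
  classical
  have h : MonoidAlgebra.of ℤ C d * (1 + (χ d : ℤ) • MonoidAlgebra.of ℤ C d) =
      (χ d : ℤ) • (1 + (χ d : ℤ) • MonoidAlgebra.of ℤ C d) := by
    rw [smul_add, Int.units_smul_smul_self, mul_add, mul_one, mul_smul_comm, ← map_mul, ← pow_two,
      h2, map_one, add_comm]
  rw [← Finset.mul_prod_erase _ _ (Finset.mem_univ d), ← mul_assoc, h, smul_mul_assoc]

theorem card_smul_prod_one_add_smul_of (h2 : ∀ c : C, c ^ 2 = 1) (χ : C →* ℤˣ) :
    (Fintype.card C : ℤ) • ∏ c : C, (1 + (χ c : ℤ) • MonoidAlgebra.of ℤ C c) =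
      2 ^ Fintype.card C * ∑ d : C, (χ d : ℤ) • MonoidAlgebra.of ℤ C d := by
  rw [← Finset.card_univ, ← mul_prod_eq_pow_card_mul Finset.univ
    (fun c => 1 + (χ c : ℤ) • MonoidAlgebra.of ℤ C c)]
  · rw [Finset.sum_mul]
    simp_rw [smul_mul_assoc, of_mul_prod_one_add_smul_of h2, Int.units_smul_smul_self]
    rw [Finset.sum_const, natCast_zsmul]
  · intro c _
    rw [mul_add, mul_one, mul_smul_comm, sum_smul_of_mul_of, Int.units_smul_smul_self, two_mul]

end CharacterProducts

/-- For a finite elementary abelian 2-group C, the sum over all characters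
χ : C → {±1} of the products ∏_{c ∈ C} (1 + χ(c)·c), computed in the integral group
ring ℤ[C], equals 2^|C|. -/
theorem sum_character_products_eq_two_pow_card
    (C : Type*) [CommGroup C] [Fintype C] (h2 : ∀ c : C, c ^ 2 = 1) :
    ∑ᶠ χ : C →* ℤˣ,
        ∏ c : C, (1 + ((χ c : ℤ) • MonoidAlgebra.of ℤ C c)) =
      (2 : MonoidAlgebra ℤ C) ^ Fintype.card C := by
  have : Finite (C →* ℤˣ) := Finite.of_injective (fun χ : C →* ℤˣ => (χ : C → ℤˣ))
    DFunLike.coe_injective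
  have := Fintype.ofFinite (C →* ℤˣ)
  rw [finsum_eq_sum_of_fintype]
  have hC : (Fintype.card C : ℤ) ≠ 0 := by exact_mod_cast Fintype.card_ne_zero
  apply smul_right_injective (MonoidAlgebra ℤ C) hC
  simp only
  rw [Finset.smul_sum, Finset.sum_congr rfl fun χ _ => card_smul_prod_one_add_smul_of h2 χ,
    ← Finset.mul_sum, sum_sum_monoidHom_smul_of h2, mul_smul_comm, mul_one]
end

section
/- Let G = D∞ × D∞ = (⟨b₁⟩₂ ⋉ ⟨a₁⟩∞) × (⟨b₂⟩₂ ⋉ ⟨a₂⟩∞) and let H = ⟨b, a⟩ where b = b₁b₂ and a = a₁³a₂⁵. Then H is isomorphic to the infinite dihedral group but H is not verbally closed in G. -/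
namespace DihedralGroup

/-- Multiplication of the index by `c`, as an endomorphism of the dihedral group. -/
def scale {n : ℕ} (c : ZMod n) : DihedralGroup n →* DihedralGroup n :=
  MonoidHom.mk'
    (fun
      | r i => r (c * i)
      | sr i => sr (c * i))
    (by rintro (i | i) (j | j) <;> simp [mul_add, mul_sub])

@[simp]
theorem scale_r {n : ℕ} (c i : ZMod n) : scale c (r i) = r (c * i) := rfl

@[simp]
theorem scale_sr {n : ℕ} (c i : ZMod n) : scale c (sr i) = sr (c * i) := rfl

theorem scale_injective {c : ZMod 0} (hc : c ≠ 0) : Function.Injective (scale c) := by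
  have hc' : Function.Injective (fun i : ZMod 0 => c * i) := mul_right_injective₀ (M₀ := ℤ) hc
  rintro (i | i) (j | j) h <;> simp only [scale_r, scale_sr, r.injEq, sr.injEq, reduceCtorEq] at h
  · rw [hc' h]
  · rw [hc' h]

theorem closure_r_one_sr_zero :
    Subgroup.closure {(r 1 : DihedralGroup 0), sr 0} = ⊤ := by
  have hr (i : ZMod 0) : r i ∈ Subgroup.closure {(r 1 : DihedralGroup 0), sr 0} := by
    have h := Subgroup.zpow_mem _ (Subgroup.subset_closure
      (Set.mem_insert (r 1 : DihedralGroup 0) {sr 0})) (ZMod.cast i : ℤ)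
    rwa [r_zpow, one_mul, ZMod.intCast_zmod_cast] at h
  refine eq_top_iff.2 ?_
  rintro (i | i) -
  · exact hr i
  · have h := Subgroup.mul_mem _ (Subgroup.subset_closure
      (Set.mem_insert_of_mem (r 1 : DihedralGroup 0) (Set.mem_singleton (sr 0)))) (hr i)
    rwa [sr_mul_r, zero_add] at h

theorem sr_pow_two_mul {n : ℕ} (i : ZMod n) (k : ℕ) : sr i ^ (2 * k) = 1 := by
  rw [pow_mul, pow_two, sr_mul_self, one_pow]

/-- The embedding `r i ↦ (r (3 * i), r (5 * i))`, `sr i ↦ (sr (3 * i), sr (5 * i))`. -/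
def scaleThreeFive : DihedralGroup 0 →* DihedralGroup 0 × DihedralGroup 0 :=
  (scale 3).prod (scale 5)

theorem scaleThreeFive_injective : Function.Injective scaleThreeFive := fun _ _ h =>
  scale_injective (c := 3) (by decide) (congrArg Prod.fst h)

theorem range_scaleThreeFive :
    scaleThreeFive.range = Subgroup.closure {(r 3, r 5), (sr 0, sr 0)} := by
  rw [MonoidHom.range_eq_map, ← closure_r_one_sr_zero, MonoidHom.map_closure, Set.image_pair]
  simp [scaleThreeFive]

/-- On `DihedralGroup 0` this word takes the values `r k` where `k` is a multiple of `6` or of `10`,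
according to which of `x` and `y` are rotations. -/
def sixTenWord {G : Type*} [Group G] (x y : G) : G :=
  x ^ 18 * (y * x ^ 12 * y⁻¹) * (y ^ 20 * (x * y ^ 10 * x⁻¹))

theorem map_sixTenWord {G K : Type*} [Group G] [Group K] (f : G →* K) (x y : G) :
    f (sixTenWord x y) = sixTenWord (f x) (f y) := by
  simp [sixTenWord]

theorem sixTenWord_ne_r_two (x y : DihedralGroup 0) : sixTenWord x y ≠ r 2 := by
  have hs (i : ZMod 0) : sr i ^ 18 = 1 ∧ sr i ^ 12 = 1 ∧ sr i ^ 20 = 1 ∧ sr i ^ 10 = 1 :=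
    ⟨sr_pow_two_mul i 9, sr_pow_two_mul i 6, sr_pow_two_mul i 10, sr_pow_two_mul i 5⟩
  intro h
  obtain i | i := x <;> obtain j | j := y <;>
    simp only [sixTenWord, hs, r_pow, r_mul_r, sr_mul_r, sr_mul_sr, inv_r, inv_sr,
      one_def, r.injEq] at h
  · change ℤ at i j
    have h : (i * 18 + (j + i * 12 + -j) + (j * 20 + (i + j * 10 + -i)) : ℤ) = 2 := h
    omega
  · change ℤ at i j
    have h : (i * 18 + (j - (j + i * 12)) + (0 + (i + 0 + -i)) : ℤ) = 2 := h
    omega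
  · change ℤ at i j
    have h : (0 + (j + 0 + -j) + (j * 20 + (i - (i + j * 10))) : ℤ) = 2 := h
    omega
  · change ℤ at i j
    have h : (0 + (j - (j + 0)) + (0 + (i - (i + 0))) : ℤ) = 2 := h
    omega

theorem sixTenWord_eq :
    sixTenWord ((r 1, sr 0) : DihedralGroup 0 × DihedralGroup 0) (sr 0, r 1) =
      scaleThreeFive (r 2) := by
  decide

end DihedralGroup

/-- In G = D∞ × D∞, the subgroup generated by a = a₁³a₂⁵ and b = b₁b₂ is isomorphic to
the infinite dihedral group but is not verbally closed in G. -/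
theorem dihedral_example_not_verballyClosed :
    Nonempty
        ((Subgroup.closure
            {((DihedralGroup.r 3, DihedralGroup.r 5) :
                DihedralGroup 0 × DihedralGroup 0),
              ((DihedralGroup.sr 0, DihedralGroup.sr 0) :
                DihedralGroup 0 × DihedralGroup 0)}) ≃* DihedralGroup 0) ∧
      ¬ VerballyClosedIn (DihedralGroup 0 × DihedralGroup 0)
          (Subgroup.closure
            {((DihedralGroup.r 3, DihedralGroup.r 5) :
                DihedralGroup 0 × DihedralGroup 0),
              ((DihedralGroup.sr 0, DihedralGroup.sr 0) :
                DihedralGroup 0 × DihedralGroup 0)}) := by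
  open DihedralGroup in
  rw [← range_scaleThreeFive]
  refine ⟨⟨(MonoidHom.ofInjective scaleThreeFive_injective).symm⟩, fun hH => ?_⟩
  obtain ⟨x, hx, hw⟩ := hH 2 (sixTenWord (FreeGroup.of 0) (FreeGroup.of 1))
    (scaleThreeFive (r 2)) ⟨_, rfl⟩ ⟨![(r 1, sr 0), (sr 0, r 1)], by
      rw [map_sixTenWord]
      simpa using sixTenWord_eq⟩
  obtain ⟨u, hu⟩ := hx 0
  obtain ⟨v, hv⟩ := hx 1
  rw [map_sixTenWord, FreeGroup.lift_apply_of, FreeGroup.lift_apply_of, ← hu, ← hv,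
    ← map_sixTenWord] at hw
  exact sixTenWord_ne_r_two u v (scaleThreeFive_injective hw)
end
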